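/- arXiv:1906.02237 — 4 statements merged into one kernel-verified Lean document; each statement's English description precedes it below -/
import Mathlib

section
/- Suppose the weight data (c; a₁,…,a_s; b₁,…,b_t) is tightly constrained with lower bound r₀. Then for every r ∈ {0, 1, …, λ−1} there exist an integer γ_r and x₀ ∈ ℤ≥0 such that for all integers x ≥ x₀: cap(r + λx) = (λ/2)·x² + (L − 1 − λ/2 + r)·x + γ_r. In particular, on each residue class modulo λ the cap function is eventually given by a quadratic polynomial with leading coefficient λ/2 and linear coefficient L − 1 − λ/2 + r. -/
open scoped BigOperators

noncomputable section

/-- `C(T) = δ(δ+3)/2 − Σᵢ αᵢ(αᵢ+1)/2 − Σⱼ βⱼ(βⱼ+1)/2` (each division is exact). -/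
def Cfun (s t : ℕ) (T : ℤ × (Fin s → ℤ) × (Fin t → ℤ)) : ℤ :=
  T.1 * (T.1 + 3) / 2 - (∑ i, T.2.1 i * (T.2.1 i + 1) / 2)
    - (∑ j, T.2.2 j * (T.2.2 j + 1) / 2)

/-- `E(T) = δc − Σᵢ αᵢaᵢ − Σⱼ βⱼbⱼ`. -/
def Efun (s t : ℕ) (c : ℤ) (a : Fin s → ℤ) (b : Fin t → ℤ)
    (T : ℤ × (Fin s → ℤ) × (Fin t → ℤ)) : ℤ :=
  T.1 * c - (∑ i, T.2.1 i * a i) - (∑ j, T.2.2 j * b j)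

/-- Tuples with all entries nonnegative. -/
def NonnegT (s t : ℕ) (T : ℤ × (Fin s → ℤ) × (Fin t → ℤ)) : Prop :=
  0 ≤ T.1 ∧ (∀ i, 0 ≤ T.2.1 i) ∧ (∀ j, 0 ≤ T.2.2 j)

/-- `M(r)`: the maximum of `C(T)` over nonnegative tuples with `E(T) ≤ r`. -/
def Mfun (s t : ℕ) (c : ℤ) (a : Fin s → ℤ) (b : Fin t → ℤ) (r : ℤ) : ℤ :=
  sSup {m : ℤ | ∃ T, NonnegT s t T ∧ Efun s t c a b T ≤ r ∧ Cfun s t T = m}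

/-- The cap function `cap(r) = 1 + M(r)`. -/
def capW (s t : ℕ) (c : ℤ) (a : Fin s → ℤ) (b : Fin t → ℤ) (r : ℤ) : ℤ :=
  1 + Mfun s t c a b r

/-- `L = (c+1)(c+2)/2 − Σᵢ aᵢ(aᵢ+1)/2 − Σⱼ bⱼ(bⱼ+1)/2`. -/
def Lval (s t : ℕ) (c : ℤ) (a : Fin s → ℤ) (b : Fin t → ℤ) : ℤ :=
  (c + 1) * (c + 2) / 2 - (∑ i, a i * (a i + 1) / 2) - (∑ j, b j * (b j + 1) / 2)

/-- `λ = c² − Σᵢ aᵢ² − Σⱼ bⱼ²`. -/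
def lamW (s t : ℕ) (c : ℤ) (a : Fin s → ℤ) (b : Fin t → ℤ) : ℤ :=
  c ^ 2 - (∑ i, a i ^ 2) - (∑ j, b j ^ 2)

/-- The weight data is tightly constrained with lower bound `r₀`: for every
`r ≥ r₀` the maximum `M(r)` is attained at a tuple with `E(T) = r`. -/
def TightW (s t : ℕ) (c : ℤ) (a : Fin s → ℤ) (b : Fin t → ℤ) (r₀ : ℤ) : Prop :=
  ∀ r : ℤ, r₀ ≤ r → ∃ T, NonnegT s t T ∧ Efun s t c a b T = r ∧
    Cfun s t T = Mfun s t c a b r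

/-- `c_k`: the minimum of `E(T)` over nonnegative tuples with `C(T) ≥ k`. -/
def ckW (s t : ℕ) (c : ℤ) (a : Fin s → ℤ) (b : Fin t → ℤ) (k : ℕ) : ℤ :=
  sInf {e : ℤ | ∃ T, NonnegT s t T ∧ (k : ℤ) ≤ Cfun s t T ∧ Efun s t c a b T = e}


lemma aux_two (n k : ℤ) (hk : k = 1 ∨ k = 3) : 2 * (n * (n + k) / 2) = n * (n + k) := by
  apply Int.mul_ediv_cancel'
  rcases Int.even_or_odd' n with ⟨m, rfl | rfl⟩ <;> rcases hk with rfl | rfl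
  · exact ⟨m * (2 * m + 1), by ring⟩
  · exact ⟨m * (2 * m + 3), by ring⟩
  · exact ⟨(2 * m + 1) * (m + 1), by ring⟩
  · exact ⟨(2 * m + 1) * (m + 2), by ring⟩

lemma two_Cfun (s t : ℕ) (T : ℤ × (Fin s → ℤ) × (Fin t → ℤ)) :
    2 * Cfun s t T = T.1 ^ 2 + 3 * T.1 - ∑ i, Sum.elim T.2.1 T.2.2 i ^ 2
      - ∑ i, Sum.elim T.2.1 T.2.2 i := by
  have h1 : 2 * (∑ i, T.2.1 i * (T.2.1 i + 1) / 2) = ∑ i, T.2.1 i ^ 2 + ∑ i, T.2.1 i := by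
    rw [Finset.mul_sum, ← Finset.sum_add_distrib]
    exact Finset.sum_congr rfl fun i _ => by rw [aux_two _ 1 (Or.inl rfl)]; ring
  have h2 : 2 * (∑ i, T.2.2 i * (T.2.2 i + 1) / 2) = ∑ i, T.2.2 i ^ 2 + ∑ i, T.2.2 i := by
    rw [Finset.mul_sum, ← Finset.sum_add_distrib]
    exact Finset.sum_congr rfl fun i _ => by rw [aux_two _ 1 (Or.inl rfl)]; ring
  have h3 := aux_two T.1 3 (Or.inr rfl)
  simp only [Cfun, Fintype.sum_sum_type, Sum.elim_inl, Sum.elim_inr]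
  linarith

lemma Efun_eq (s t : ℕ) (c : ℤ) (a : Fin s → ℤ) (b : Fin t → ℤ)
    (T : ℤ × (Fin s → ℤ) × (Fin t → ℤ)) :
    Efun s t c a b T = T.1 * c - ∑ i, Sum.elim T.2.1 T.2.2 i * Sum.elim a b i := by
  simp only [Efun, Fintype.sum_sum_type, Sum.elim_inl, Sum.elim_inr]; ring

lemma lamW_eq (s t : ℕ) (c : ℤ) (a : Fin s → ℤ) (b : Fin t → ℤ) :
    lamW s t c a b = c ^ 2 - ∑ i, Sum.elim a b i ^ 2 := by
  simp only [lamW, Fintype.sum_sum_type, Sum.elim_inl, Sum.elim_inr]; ring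

lemma two_Lval (s t : ℕ) (c : ℤ) (a : Fin s → ℤ) (b : Fin t → ℤ) :
    2 * (Lval s t c a b - 1) = c ^ 2 + 3 * c - ∑ i, Sum.elim a b i ^ 2
      - ∑ i, Sum.elim a b i := by
  have h := two_Cfun s t (c, a, b)
  have h3 := aux_two c 3 (Or.inr rfl)
  have h4 := aux_two (c + 1) 1 (Or.inl rfl)
  rw [show c + 1 + 1 = c + 2 by ring] at h4
  simp only [Cfun] at h
  simp only [Lval]
  linarith

lemma core_bdd {ι : Type*} [Fintype ι] (c d R : ℤ) (w u : ι → ℤ) (hc : 0 < c) (hd : 0 ≤ d)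
    (hR : 0 ≤ R) (hl : 0 < c ^ 2 - ∑ i, w i ^ 2) (hE : d * c - ∑ i, u i * w i ≤ R)
    (hN : ∑ i, u i ^ 2 ≤ d ^ 2 + 3 * d) : d ≤ 2 * R * c + 3 * c ^ 2 + R := by
  by_cases h : d * c < R
  · nlinarith [mul_nonneg hR hc.le]
  push Not at h
  have cs := Finset.sum_mul_sq_le_sq_mul_sq Finset.univ u w
  have h1 : (d * c - R) ^ 2 ≤ (∑ i, u i * w i) ^ 2 :=
    pow_le_pow_left₀ (by linarith) (by linarith) 2
  have hN0 : 0 ≤ ∑ i, u i ^ 2 := Finset.sum_nonneg fun i _ => sq_nonneg _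
  have h2 : (∑ i, u i ^ 2) * (∑ i, w i ^ 2) ≤ (d ^ 2 + 3 * d) * (c ^ 2 - 1) :=
    mul_le_mul hN (by linarith) (Finset.sum_nonneg fun i _ => sq_nonneg _) (by linarith)
  have h3 : d * d ≤ d * (2 * R * c + 3 * c ^ 2) := by nlinarith
  rcases hd.eq_or_lt with h0 | h0
  · rw [← h0]; positivity
  · have := le_of_mul_le_mul_left h3 h0
    linarith

lemma core_quad {ι : Type*} [Fintype ι] (c d R : ℤ) (w u : ι → ℤ) (l : ℤ)
    (hc : 0 < c) (hl : 0 < l) (hl' : l = c ^ 2 - ∑ i, w i ^ 2)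
    (hE : d * c - ∑ i, u i * w i = R) :
    l ^ 2 * (d ^ 2 + 3 * d - ∑ i, u i ^ 2 - ∑ i, u i) ≤
      l * R ^ 2 + l * R * (3 * c - ∑ i, w i) + l * ∑ i, (c * (3 * w i - c)) ^ 2 := by
  set U : ι → ℤ := fun i => l * u i - R * w i with hU
  set U0 : ℤ := l * d - R * c with hU0
  have eUU : ∑ i, U i ^ 2 = l ^ 2 * ∑ i, u i ^ 2 - 2 * l * R * ∑ i, u i * w i
      + R ^ 2 * ∑ i, w i ^ 2 := by
    simp only [Finset.mul_sum, ← Finset.sum_sub_distrib, ← Finset.sum_add_distrib]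
    exact Finset.sum_congr rfl fun i _ => by simp only [hU]; ring
  have eU : ∑ i, U i = l * ∑ i, u i - R * ∑ i, w i := by
    simp only [Finset.mul_sum, ← Finset.sum_sub_distrib, hU]
  have eUw : ∑ i, U i * w i = l * ∑ i, u i * w i - R * ∑ i, w i ^ 2 := by
    simp only [Finset.mul_sum, ← Finset.sum_sub_distrib]
    exact Finset.sum_congr rfl fun i _ => by simp only [hU]; ring
  have cs := Finset.sum_mul_sq_le_sq_mul_sq Finset.univ U w
  have ek : ∑ i, c * (3 * w i - c) * U i = 3 * c * ∑ i, U i * w i - c ^ 2 * ∑ i, U i := by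
    simp only [Finset.mul_sum, ← Finset.sum_sub_distrib]
    exact Finset.sum_congr rfl fun i _ => by ring
  have hk : ∑ i, c * (3 * w i - c) * U i ≤ ∑ i, U i ^ 2 + ∑ i, (c * (3 * w i - c)) ^ 2 := by
    rw [← Finset.sum_add_distrib]
    exact Finset.sum_le_sum fun i _ => by
      nlinarith [sq_nonneg (c * (3 * w i - c) - U i), sq_nonneg (c * (3 * w i - c)),
        sq_nonneg (U i)]
  have hK0 : 0 ≤ ∑ i, (c * (3 * w i - c)) ^ 2 := Finset.sum_nonneg fun i _ => sq_nonneg _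
  generalize ∑ i, (c * (3 * w i - c)) ^ 2 = K at *
  generalize ∑ i, c * (3 * w i - c) * U i = Q at *
  generalize ∑ i, U i ^ 2 = UU at *
  generalize ∑ i, U i * w i = Uw at *
  generalize ∑ i, U i = SU at *
  generalize ∑ i, u i * w i = P at *
  generalize ∑ i, w i ^ 2 = A at *
  generalize ∑ i, u i ^ 2 = N at *
  generalize ∑ i, u i = S at *
  generalize ∑ i, w i = W at *
  have hA : A = c ^ 2 - l := by linarith
  have hP : P = d * c - R := by linarith
  have orth : c * U0 = Uw := by rw [eUw, hU0, hP, hA]; ring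
  have main : c ^ 2 * (U0 ^ 2 - UU + l * (3 * U0 - SU)) ≤ l * K := by
    have e1 : c ^ 2 * (U0 ^ 2 - UU + l * (3 * U0 - SU)) = Uw ^ 2 - c ^ 2 * UU + l * Q := by
      rw [ek, ← orth]; ring
    rw [hA] at cs
    have := mul_le_mul_of_nonneg_left hk hl.le
    rw [e1]; nlinarith
  have main2 : U0 ^ 2 - UU + l * (3 * U0 - SU) ≤ l * K := by
    by_contra hcon
    push Not at hcon
    have h0 : 0 ≤ l * K := mul_nonneg hl.le hK0
    have : 1 ≤ c ^ 2 := by nlinarith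
    nlinarith
  have e2 : l ^ 2 * (d ^ 2 + 3 * d - N - S) = l * R ^ 2 + l * R * (3 * c - W)
      + (U0 ^ 2 - UU + l * (3 * U0 - SU)) := by
    rw [eUU, eU, hU0, hP, hA]; ring
  linarith

lemma C_bdd (s t : ℕ) (c : ℤ) (a : Fin s → ℤ) (b : Fin t → ℤ)
    (hc : 0 < c) (hlam : 0 < lamW s t c a b) (R : ℤ) (hR : 0 ≤ R) :
    BddAbove {m : ℤ | ∃ T, NonnegT s t T ∧ Efun s t c a b T ≤ R ∧ Cfun s t T = m} := by
  set D := 2 * R * c + 3 * c ^ 2 + R with hD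
  have hD0 : 0 ≤ D := by positivity
  refine ⟨D ^ 2 + 3 * D, ?_⟩
  rintro m ⟨T, ⟨h1, h2, h3⟩, hE, rfl⟩
  by_contra hcon
  push Not at hcon
  have hC := two_Cfun s t T
  rw [Efun_eq] at hE
  rw [lamW_eq] at hlam
  have hS : 0 ≤ ∑ i, Sum.elim T.2.1 T.2.2 i :=
    Finset.sum_nonneg fun i _ => by rcases i with i | i <;> simp [h2, h3]
  have hN : 0 ≤ ∑ i, Sum.elim T.2.1 T.2.2 i ^ 2 := Finset.sum_nonneg fun i _ => sq_nonneg _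
  have hd := core_bdd c T.1 R (Sum.elim a b) (Sum.elim T.2.1 T.2.2) hc h1 hR hlam hE
    (by nlinarith)
  rw [← hD] at hd
  nlinarith

lemma C_shift (s t : ℕ) (c : ℤ) (a : Fin s → ℤ) (b : Fin t → ℤ)
    (T : ℤ × (Fin s → ℤ) × (Fin t → ℤ)) :
    Efun s t c a b (T.1 + c, fun i => T.2.1 i + a i, fun j => T.2.2 j + b j) =
      Efun s t c a b T + lamW s t c a b ∧
    Cfun s t (T.1 + c, fun i => T.2.1 i + a i, fun j => T.2.2 j + b j) =
      Cfun s t T + Efun s t c a b T + (Lval s t c a b - 1) := by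
  have hS : Sum.elim (fun i => T.2.1 i + a i) (fun j => T.2.2 j + b j) =
      fun i => Sum.elim T.2.1 T.2.2 i + Sum.elim a b i := by
    ext i; rcases i with i | i <;> rfl
  constructor
  · simp only [Efun_eq, lamW_eq, hS, add_mul, Finset.sum_add_distrib, sq]; ring
  · have h1 := two_Cfun s t (T.1 + c, fun i => T.2.1 i + a i, fun j => T.2.2 j + b j)
    have h2 := two_Cfun s t T
    have h3 := two_Lval s t c a b
    have h4 := Efun_eq s t c a b T
    simp only [hS, add_sq, Finset.sum_add_distrib, mul_assoc, ← Finset.mul_sum] at h1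
    linarith

lemma capW_eventually_aux (s t : ℕ) (c : ℤ) (a : Fin s → ℤ) (b : Fin t → ℤ)
    (hc : 0 < c) (ha : ∀ i, 0 < a i) (hb : ∀ j, 0 < b j)
    (hlam : 0 < lamW s t c a b)
    (r₀ : ℤ) (hr₀ : 0 ≤ r₀) (htight : TightW s t c a b r₀) (r : ℤ) (hr : 0 ≤ r) :
    ∃ γ : ℤ, ∃ x₀ : ℕ, ∀ x : ℤ, (x₀ : ℤ) ≤ x →
      2 * Mfun s t c a b (r + lamW s t c a b * x) =
        lamW s t c a b * (x ^ 2 - x) + 2 * (r + (Lval s t c a b - 1)) * x + 2 * γ := by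
  set l := lamW s t c a b with hl
  set K := Lval s t c a b - 1 with hK
  set q : ℤ → ℤ := fun x => l * (x * (x + 1) / 2 - x) + (r + K) * x with hq
  have hq2 : ∀ x, 2 * q x = l * (x ^ 2 - x) + 2 * (r + K) * x := fun x => by
    have := aux_two x 1 (Or.inl rfl)
    simp only [hq]; linear_combination l * this
  set g : ℤ → ℤ := fun x => Mfun s t c a b (r + l * x) - q x with hg
  have hge : ∀ x, r₀ ≤ x → r₀ ≤ r + l * x := fun x hx => by nlinarith
  have hstep : ∀ x, r₀ ≤ x → g x ≤ g (x + 1) := by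
    intro x hx
    obtain ⟨T, ⟨h1, h2, h3⟩, hE, hC⟩ := htight _ (hge x hx)
    obtain ⟨e1, e2⟩ := C_shift s t c a b T
    have hM : Cfun s t (T.1 + c, fun i => T.2.1 i + a i, fun j => T.2.2 j + b j) ≤
        Mfun s t c a b (r + l * (x + 1)) := by
      apply le_csSup (C_bdd s t c a b hc hlam _ (hr₀.trans (hge _ (by linarith))))
      refine ⟨_, ⟨?_, ?_, ?_⟩, ?_, rfl⟩
      · exact add_nonneg h1 hc.le
      · exact fun i => add_nonneg (h2 i) (ha i).le
      · exact fun i => add_nonneg (h3 i) (hb i).le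
      · rw [e1, hE, ← hl]; linarith
    have hqq : q (x + 1) = q x + (r + l * x) + K := by
      have := hq2 x
      have := hq2 (x + 1)
      nlinarith
    simp only [hg]
    rw [e2, hC, hE] at hM
    linarith
  have hmono : ∀ x, r₀ ≤ x → ∀ y, x ≤ y → g x ≤ g y := by
    intro x hx y hy
    induction y, hy using Int.le_induction with
    | base => exact le_rfl
    | succ n hn ih => exact ih.trans (hstep n (hx.trans hn))
  set W := ∑ i, Sum.elim a b i with hW
  set B := l * r ^ 2 + l * r * (3 * c - W)
    + l * ∑ i, (c * (3 * Sum.elim a b i - c)) ^ 2 with hB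
  have hbd : ∀ x, r₀ ≤ x → g x ≤ |B| := by
    intro x hx
    obtain ⟨T, -, hE, hC⟩ := htight _ (hge x hx)
    have h1 := core_quad c T.1 (r + l * x) (Sum.elim a b) (Sum.elim T.2.1 T.2.2) l hc hlam
      (lamW_eq s t c a b) (by rw [← Efun_eq, hE])
    rw [← two_Cfun, hC] at h1
    have h2 := hq2 x
    have h3 := two_Lval s t c a b
    have h4 := lamW_eq s t c a b
    rw [← hl] at h4
    have h5 : 2 * K = l + 3 * c - W := by linarith
    have h6 : l ^ 2 * (2 * g x) ≤ B := by
      have e : l ^ 2 * (2 * q x) = l ^ 2 * (l * x ^ 2 + 2 * r * x + (3 * c - W) * x) := by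
        rw [h2]; linear_combination l ^ 2 * x * h5
      simp only [hg, mul_sub]
      rw [e]
      linarith
    by_contra hcon
    push Not at hcon
    have : B ≤ |B| := le_abs_self B
    have : 0 ≤ |B| := abs_nonneg B
    have : 1 ≤ l ^ 2 := by nlinarith
    nlinarith
  obtain ⟨γ, ⟨x2, hx2, rfl⟩, hmax⟩ := Int.exists_greatest_of_bdd
    (P := fun z => ∃ x, r₀ ≤ x ∧ g x = z)
    ⟨|B|, by rintro z ⟨x, hx, rfl⟩; exact hbd x hx⟩ ⟨_, r₀, le_rfl, rfl⟩
  refine ⟨g x2, x2.toNat, fun x hx => ?_⟩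
  have hx' : x2 ≤ x := (Int.self_le_toNat x2).trans hx
  have e : g x = g x2 := le_antisymm (hmax _ ⟨x, hx2.trans hx', rfl⟩) (hmono _ hx2 _ hx')
  rw [← e, ← hq2]
  simp only [hg]; ring

/-- For tightly constrained weight data, on each residue
class `r` mod `λ` the cap function is eventually the quadratic polynomial
`(λ/2)x² + (L − 1 − λ/2 + r)x + γ_r`. -/
theorem capW_eventually_quadratic (s t : ℕ) (c : ℤ) (a : Fin s → ℤ) (b : Fin t → ℤ)
    (hc : 0 < c) (ha : ∀ i, 0 < a i) (hb : ∀ j, 0 < b j)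
    (hlam : 0 < lamW s t c a b)
    (r₀ : ℤ) (hr₀ : 0 ≤ r₀) (htight : TightW s t c a b r₀) :
    ∀ r : ℤ, 0 ≤ r → r < lamW s t c a b →
      ∃ γ : ℤ, ∃ x₀ : ℕ, ∀ x : ℤ, (x₀ : ℤ) ≤ x →
        (capW s t c a b (r + lamW s t c a b * x) : ℚ) =
          (lamW s t c a b : ℚ) / 2 * (x : ℚ) ^ 2 +
            ((Lval s t c a b : ℚ) - 1 - (lamW s t c a b : ℚ) / 2 + (r : ℚ)) * (x : ℚ) +
            (γ : ℚ) := by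
  intro r hr _
  obtain ⟨γ, x₀, h⟩ := capW_eventually_aux s t c a b hc ha hb hlam r₀ hr₀ htight r hr
  refine ⟨γ + 1, x₀, fun x hx => ?_⟩
  have h1 := h x hx
  have h2 : (2 * Mfun s t c a b (r + lamW s t c a b * x) : ℚ) =
      lamW s t c a b * ((x : ℚ) ^ 2 - x) + 2 * (r + ((Lval s t c a b : ℚ) - 1)) * x + 2 * γ := by
    exact_mod_cast h1
  simp only [capW]
  push_cast
  linarith

end
end

section
/- Fix integers s,t ≥ 0, integers c, a₁,…,a_s, b₁,…,b_t, set λ := c² − (a₁²+⋯+a_s²) − (b₁²+⋯+b_t²), and let w := (c, a₁,…,a_s, b₁,…,b_t). Let r be an integer and suppose T₀ is an integer tuple (entries in ℤ, possibly negative) with E(T₀) = r that maximizes C among integer tuples with E-value r, i.e. C(T) ≤ C(T₀) for every integer tuple T with E(T) = r. Then T₀ + w maximizes C among integer tuples with E-value r + λ: for every integer tuple T′ with E(T′) = r + λ one has C(T′) ≤ C(T₀ + w). -/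
open scoped BigOperators

noncomputable section

theorem half_shift (k x y : ℤ) (hk : k = 1 ∨ k = 3) :
    (x + y) * (x + y + k) / 2 = x * (x + k) / 2 + x * y + y * (y + k) / 2 := by
  have key : ∀ z : ℤ, ∃ m, z * (z + k) = 2 * m := by
    intro z
    have : Even (z * (z + k)) := by
      rcases hk with rfl | rfl <;> simp [Int.even_mul, Int.even_add, parity_simps] <;> grind
    obtain ⟨m, hm⟩ := this
    exact ⟨m, by omega⟩
  obtain ⟨m, hm⟩ := key x
  obtain ⟨n, hn⟩ := key y
  have h : (x + y) * (x + y + k) = 2 * (m + x * y + n) := by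
    linear_combination hm + hn
  rw [h, hm, hn]
  simp

theorem Cfun_shift (s t : ℕ) (c : ℤ) (a : Fin s → ℤ) (b : Fin t → ℤ)
    (T : ℤ × (Fin s → ℤ) × (Fin t → ℤ)) :
    Cfun s t (T.1 + c, T.2.1 + a, T.2.2 + b)
      = Cfun s t T + Efun s t c a b T + Cfun s t (c, a, b) := by
  simp only [Cfun, Efun, Pi.add_apply, half_shift 3 _ _ (Or.inr rfl),
    half_shift 1 _ _ (Or.inl rfl), Finset.sum_add_distrib]
  ring

/-- If an integer tuple `T₀` with `E(T₀) = r` maximizes `C`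
among integer tuples with `E`-value `r`, then `T₀ + w` (with
`w = (c, a₁,…,a_s, b₁,…,b_t)`) maximizes `C` among integer tuples with
`E`-value `r + λ`. -/
theorem shift_maximizer (s t : ℕ) (c : ℤ) (a : Fin s → ℤ) (b : Fin t → ℤ)
    (r : ℤ) (T₀ : ℤ × (Fin s → ℤ) × (Fin t → ℤ))
    (hE : Efun s t c a b T₀ = r)
    (hmax : ∀ T : ℤ × (Fin s → ℤ) × (Fin t → ℤ),
      Efun s t c a b T = r → Cfun s t T ≤ Cfun s t T₀) :
    ∀ T' : ℤ × (Fin s → ℤ) × (Fin t → ℤ),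
      Efun s t c a b T' = r + lamW s t c a b →
      Cfun s t T' ≤ Cfun s t (T₀.1 + c, T₀.2.1 + a, T₀.2.2 + b) := by
  intro T' hT'
  have hE' : Efun s t c a b (T'.1 - c, T'.2.1 - a, T'.2.2 - b) = r := by
    simp only [Efun, lamW, Pi.sub_apply, sub_mul, Finset.sum_sub_distrib] at hT' ⊢
    simp only [pow_two] at hT'
    linarith
  have h1 := hmax _ hE'
  have h2 := Cfun_shift s t c a b (T'.1 - c, T'.2.1 - a, T'.2.2 - b)
  have h3 := Cfun_shift s t c a b T₀
  simp only [sub_add_cancel] at h2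
  change Cfun s t T' = _ at h2
  rw [h2, h3, hE, hE']
  linarith

end
end

section
/- Let Ω and Λ be compact convex polygons in ℝ² with nonempty interior such that every edge of Λ is parallel to an edge of Ω. Then ℓ_Ω(∂Λ) = ℓ_Λ(∂Ω); that is, the Ω-perimeter of Λ equals the Λ-perimeter of Ω. -/
open scoped BigOperators Pointwise

noncomputable section

/-- Planar cross product `det(v,p) = v₁p₂ − v₂p₁`. -/
def det2 (v p : ℝ × ℝ) : ℝ := v.1 * p.2 - v.2 * p.1

/-- The `Ω`-length of a vector `v`: `max_{p ∈ Ω} det(v,p)`. -/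
def omegaLen (Ω : Set (ℝ × ℝ)) (v : ℝ × ℝ) : ℝ := sSup (det2 v '' Ω)

/-- A (possibly degenerate) compact convex polygon with vertices listed in
clockwise order: a cyclic (period `n`) list of pairwise distinct vertices such
that the polygon (the convex hull of the vertices) lies in the right
half-plane of every directed edge. -/
structure ClockPolygon where
  n : ℕ
  npos : 0 < n
  verts : ℕ → ℝ × ℝ
  periodic : ∀ i, verts (i + n) = verts i
  inj : ∀ i j, i < n → j < n → verts i = verts j → i = j
  clockwise : ∀ i, ∀ q ∈ convexHull ℝ (Set.range verts),
      det2 (verts (i + 1) - verts i) (q - verts i) ≤ 0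

/-- The underlying point set of a polygon. -/
def ClockPolygon.body (P : ClockPolygon) : Set (ℝ × ℝ) :=
  convexHull ℝ (Set.range P.verts)

/-- The `Ω`-perimeter `ℓ_Ω(∂Λ)`: the sum of the `Ω`-lengths of the edge
vectors of `Λ`. -/
def omegaPerim (Ω : Set (ℝ × ℝ)) (P : ClockPolygon) : ℝ :=
  ∑ i ∈ Finset.range P.n, omegaLen Ω (P.verts (i + 1) - P.verts i)

/-- Lattice points of the plane. -/
def IsLatticePt (p : ℝ × ℝ) : Prop := (∃ m : ℤ, p.1 = m) ∧ (∃ m : ℤ, p.2 = m)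

/-- Rational points of the plane. -/
def IsRationalPt (p : ℝ × ℝ) : Prop := (∃ q : ℚ, p.1 = q) ∧ (∃ q : ℚ, p.2 = q)

/-- The number of lattice points in a set. -/
def latticeCount (S : Set (ℝ × ℝ)) : ℕ := {p ∈ S | IsLatticePt p}.ncard

/-- Competitor convex lattice domains: convex hulls of finite nonempty sets of
lattice points in `ℝ≥0²`, containing the origin and closed under taking
coordinate rectangles. -/
def IsCompetitor (P : ClockPolygon) : Prop :=
  (∀ i, IsLatticePt (P.verts i)) ∧
  (∀ i, 0 ≤ (P.verts i).1 ∧ 0 ≤ (P.verts i).2) ∧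
  (((0 : ℝ), (0 : ℝ)) ∈ P.body) ∧
  ∀ q ∈ P.body, Set.Icc (0 : ℝ) q.1 ×ˢ Set.Icc (0 : ℝ) q.2 ⊆ P.body

/-- ECH capacities of `X_Ω`, via Cristofaro-Gardiner's combinatorial formula
(taken as a definition). -/
def echCap (Ω : Set (ℝ × ℝ)) (k : ℕ) : ℝ :=
  sInf { r | ∃ P : ClockPolygon, IsCompetitor P ∧
      latticeCount P.body = k + 1 ∧ omegaPerim Ω P = r }

/-- The cap function `cap_{X_Ω}(r) = #{k : c_k(X_Ω) ≤ r}`. -/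
def capFn (Ω : Set (ℝ × ℝ)) (r : ℝ) : ℕ := {k : ℕ | echCap Ω k ≤ r}.ncard

/-- A convex domain: a convex polygon in `ℝ≥0²` with nonempty interior,
containing the origin and closed under taking coordinate rectangles. -/
structure ConvexDomain where
  P : ClockPolygon
  int_nonempty : (interior P.body).Nonempty
  nonneg : ∀ q ∈ P.body, 0 ≤ q.1 ∧ 0 ≤ q.2
  zero_mem : (((0 : ℝ), (0 : ℝ)) ∈ P.body)
  rect : ∀ q ∈ P.body, Set.Icc (0 : ℝ) q.1 ×ˢ Set.Icc (0 : ℝ) q.2 ⊆ P.body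

def ConvexDomain.body (Ω : ConvexDomain) : Set (ℝ × ℝ) := Ω.P.body

/-- A convex lattice domain: all vertices are lattice points. -/
def ConvexDomain.IsLattice (Ω : ConvexDomain) : Prop :=
  ∀ i, IsLatticePt (Ω.P.verts i)

/-- A rational convex domain: all vertices are rational points. -/
def ConvexDomain.IsRational (Ω : ConvexDomain) : Prop :=
  ∀ i, IsRationalPt (Ω.P.verts i)

/-- `X_Ω` is tightly constrained with lower bound `r₀` if every integer
`r ≥ r₀` is a value `c_k(X_Ω)`. -/
def TightlyConstrained (Ω : ConvexDomain) (r₀ : ℕ) : Prop :=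
  ∀ r : ℕ, r₀ ≤ r → ∃ k : ℕ, echCap Ω.body k = r

/-- Every (nonzero) edge of `Q` is parallel to an edge of `P`. -/
def EdgesParallel (Q P : ClockPolygon) : Prop :=
  ∀ i < Q.n, Q.verts (i + 1) - Q.verts i ≠ 0 →
    ∃ j < P.n, ∃ t : ℝ, t ≠ 0 ∧
      Q.verts (i + 1) - Q.verts i = t • (P.verts (j + 1) - P.verts j)

/-- Euclidean inner product on the plane. -/
def dot2 (u p : ℝ × ℝ) : ℝ := u.1 * p.1 + u.2 * p.2

/-- The dual-norm value `max_{p ∈ K} u·p` (the support function of `K`). -/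
def dualLen (K : Set (ℝ × ℝ)) (u : ℝ × ℝ) : ℝ := sSup (dot2 u '' K)

/-- The pseudonorm length `ℓ'_Ω(∂Λ)` with respect to a translated body `K`. -/
def dualPerim (K : Set (ℝ × ℝ)) (P : ClockPolygon) : ℝ :=
  ∑ i ∈ Finset.range P.n, dualLen K (P.verts (i + 1) - P.verts i)


/-- lexicographically positive vectors -/
def lpos (v : ℝ × ℝ) : Prop := 0 < v.1 ∨ (v.1 = 0 ∧ 0 < v.2)

/-- clockwise angular order starting from the upward direction -/
def alt (f v : ℝ × ℝ) : Prop :=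
  (lpos f ∧ lpos (-v)) ∨ (((lpos f ∧ lpos v) ∨ (lpos (-f) ∧ lpos (-v))) ∧ det2 f v < 0)

lemma lpos_or (v : ℝ × ℝ) (h : v ≠ 0) : lpos v ∨ lpos (-v) := by
  obtain ⟨a, b⟩ := v
  simp only [lpos, Prod.fst_neg, Prod.snd_neg, Left.neg_pos_iff, neg_eq_zero]
  rcases lt_trichotomy a 0 with h1 | h1 | h1
  · tauto
  · rcases lt_trichotomy b 0 with h2 | h2 | h2
    · tauto
    · exact absurd (by rw [h1, h2]; rfl) h
    · tauto
  · tauto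

lemma lpos_asymm (v : ℝ × ℝ) (h : lpos v) : ¬ lpos (-v) := by
  obtain ⟨a, b⟩ := v
  simp only [lpos, Prod.fst_neg, Prod.snd_neg, Left.neg_pos_iff, neg_eq_zero] at *
  rintro (h1 | h1) <;> rcases h with h | h <;> linarith

lemma lpos_ne (v : ℝ × ℝ) (h : lpos v) : v ≠ 0 := by
  rintro rfl
  simp [lpos] at h

lemma lpos_add {a b : ℝ × ℝ} (ha : lpos a) (hb : lpos b) : lpos (a + b) := by
  simp only [lpos, Prod.fst_add, Prod.snd_add] at *
  rcases ha with ha | ha <;> rcases hb with hb | hb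
  · left; linarith
  · left; linarith
  · left; linarith
  · right; constructor <;> linarith

lemma lpos_smul {t : ℝ} {a : ℝ × ℝ} (ht : 0 < t) (ha : lpos a) : lpos (t • a) := by
  simp only [lpos, Prod.smul_fst, Prod.smul_snd, smul_eq_mul] at *
  rcases ha with ha | ha
  · left; positivity
  · right; refine ⟨by rw [ha.1]; simp, mul_pos ht ha.2⟩

lemma det2_neg_left (a b : ℝ × ℝ) : det2 (-a) b = - det2 a b := by simp [det2]; ring
lemma det2_neg_right (a b : ℝ × ℝ) : det2 a (-b) = - det2 a b := by simp [det2]; ring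
lemma det2_add_right (a b c : ℝ × ℝ) : det2 a (b + c) = det2 a b + det2 a c := by
  simp [det2]; ring
lemma det2_sub_right (a b c : ℝ × ℝ) : det2 a (b - c) = det2 a b - det2 a c := by
  simp [det2]; ring
lemma det2_sub_left (a b c : ℝ × ℝ) : det2 (a - b) c = det2 a c - det2 b c := by
  simp [det2]; ring
lemma det2_comm (a b : ℝ × ℝ) : det2 a b = - det2 b a := by
  simp [det2]; ring

/-- transitivity in the half plane -/
lemma lpos_trans {a b v : ℝ × ℝ} (ha : lpos a) (hb : lpos b) (hv : lpos v)
    (h1 : det2 a b ≤ 0) (h2 : det2 b v < 0) : det2 a v < 0 := by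
  by_contra h
  push Not at h
  have key : det2 a v • b + ((-det2 b v) • a + (-det2 a b) • v) = 0 := by
    ext <;> simp [det2] <;> ring
  have p1 : lpos ((-det2 b v) • a) := lpos_smul (by linarith) ha
  have p2 : lpos ((-det2 b v) • a + (-det2 a b) • v) := by
    rcases h1.lt_or_eq with h1 | h1
    · exact lpos_add p1 (lpos_smul (by linarith) hv)
    · simpa [h1] using p1
  have p3 : lpos (det2 a v • b + ((-det2 b v) • a + (-det2 a b) • v)) := by
    rcases h.lt_or_eq with h | h
    · exact lpos_add (lpos_smul h hb) p2
    · simpa [← h] using p2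
  exact lpos_ne _ p3 key

lemma lpos_trans' {a b v : ℝ × ℝ} (ha : lpos a) (hb : lpos b) (hv : lpos v)
    (h1 : det2 a b < 0) (h2 : det2 b v ≤ 0) : det2 a v < 0 := by
  by_contra h
  push Not at h
  have key : det2 a v • b + ((-det2 a b) • v + (-det2 b v) • a) = 0 := by
    ext <;> simp [det2] <;> ring
  have p1 : lpos ((-det2 a b) • v) := lpos_smul (by linarith) hv
  have p2 : lpos ((-det2 a b) • v + (-det2 b v) • a) := by
    rcases h2.lt_or_eq with h1 | h1
    · exact lpos_add p1 (lpos_smul (by linarith) ha)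
    · simpa [h1] using p1
  have p3 : lpos (det2 a v • b + ((-det2 a b) • v + (-det2 b v) • a)) := by
    rcases h.lt_or_eq with h | h
    · exact lpos_add (lpos_smul h hb) p2
    · simpa [← h] using p2
  exact lpos_ne _ p3 key

/-- `a` weakly precedes `b` as consecutive edges. -/
def ale (f g : ℝ × ℝ) : Prop :=
  det2 f g ≤ 0 ∧ ((lpos f ∧ lpos g) ∨ (lpos (-f) ∧ lpos (-g)) ∨
    (lpos f ∧ lpos (-g) ∧ det2 f g < 0))

lemma neg_neg_det (a b : ℝ × ℝ) : det2 (-a) (-b) = det2 a b := by simp [det2]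

lemma ale_alt {f g v : ℝ × ℝ} (h : ale f g) (h2 : alt g v) : alt f v := by
  have n1 := lpos_asymm g
  have n2 := lpos_asymm v
  obtain ⟨h0, h | h | h⟩ := h
  · rcases h2 with h2 | ⟨h2 | h2, h3⟩
    · left; tauto
    · right; exact ⟨Or.inl ⟨h.1, h2.2⟩, lpos_trans h.1 h.2 h2.2 h0 h3⟩
    · tauto
  · rcases h2 with h2 | ⟨h2 | h2, h3⟩
    · tauto
    · tauto
    · right; refine ⟨Or.inr ⟨h.1, h2.2⟩, ?_⟩
      have := lpos_trans h.1 h.2 h2.2 (by rwa [neg_neg_det]) (by rwa [neg_neg_det])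
      rwa [neg_neg_det] at this
  · rcases h2 with h2 | ⟨h2 | h2, h3⟩
    · tauto
    · tauto
    · left; tauto

lemma mid {f g v d : ℝ × ℝ} (hv : v ≠ 0) (h : ale f g) (h1 : alt f v) (h2 : ¬ alt g v)
    (hf : det2 f d ≤ 0) (hg : det2 g d ≤ 0) : det2 v d ≤ 0 := by
  have key : det2 v d * det2 f g = det2 f d * det2 v g + det2 g d * det2 f v := by
    simp only [det2]; ring
  have c1 := det2_comm v g
  suffices hs : det2 f g < 0 ∧ det2 v g ≤ 0 ∧ det2 f v ≤ 0 by
    by_contra hc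
    push Not at hc
    nlinarith [mul_nonneg_of_nonpos_of_nonpos hf hs.2.1,
      mul_nonneg_of_nonpos_of_nonpos hg hs.2.2, mul_neg_of_pos_of_neg hc hs.1]
  have nf := lpos_asymm f
  have ng := lpos_asymm g
  have nv := lpos_asymm v
  simp only [alt, not_or, not_and, not_lt] at h2
  obtain ⟨h2a, h2b⟩ := h2
  obtain ⟨h0, h | h | h⟩ := h
  · rcases h1 with h1 | ⟨h1 | h1, h3⟩
    · exact absurd h1.2 (h2a h.2)
    · have := h2b (Or.inl ⟨h.2, h1.2⟩)
      exact ⟨lpos_trans' h1.1 h1.2 h.2 h3 (by linarith), by linarith, h3.le⟩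
    · tauto
  · rcases h1 with h1 | ⟨h1 | h1, h3⟩
    · tauto
    · tauto
    · have := h2b (Or.inr ⟨h.2, h1.2⟩)
      have t := lpos_trans' h1.1 h1.2 h.2 (by rwa [neg_neg_det]) (by rw [neg_neg_det]; linarith)
      rw [neg_neg_det] at t
      exact ⟨t, by linarith, h3.le⟩
  · rcases h1 with h1 | ⟨h1 | h1, h3⟩
    · have := h2b (Or.inr ⟨h.2.1, h1.2⟩)
      refine ⟨h.2.2, by linarith, ?_⟩
      -- f, -g, -v positive
      have t := lpos_trans (a := -v) (b := -g) (v := f) h1.2 h.2.1 h.1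
        (by rw [neg_neg_det]; linarith)
        (by rw [det2_neg_left, det2_comm g f]; linarith [h.2.2])
      rw [det2_neg_left, det2_comm v f] at t
      linarith
    · refine ⟨h.2.2, ?_, h3.le⟩
      have t := lpos_trans (a := -g) (b := f) (v := v) h.2.1 h.1 h1.2
        (by rw [det2_neg_left, det2_comm g f]; linarith [h.2.2]) h3
      rw [det2_neg_left] at t
      linarith
    · tauto

lemma first {f v d : ℝ × ℝ} (hv : v ≠ 0) (hf : lpos f) (h : ¬ alt f v)
    (hd : d = 0 ∨ lpos d) (hfd : det2 f d ≤ 0) : det2 v d ≤ 0 := by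
  rcases hd with rfl | hd
  · simp [det2]
  simp only [alt, not_or, not_and, not_lt] at h
  obtain ⟨ha, hb⟩ := h
  have hp : lpos v := (lpos_or v hv).resolve_right (ha hf)
  have hc := hb (Or.inl ⟨hf, hp⟩)
  by_contra hcon
  push Not at hcon
  have t := lpos_trans' hd hp hf (by rw [det2_comm]; linarith) (by rw [det2_comm]; linarith)
  rw [det2_comm] at t
  linarith

lemma last {f v d : ℝ × ℝ} (hf : lpos (-f)) (h : alt f v)
    (hd : d = 0 ∨ lpos d) (hfd : det2 f d ≤ 0) : det2 v d ≤ 0 := by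
  rcases hd with rfl | hd
  · simp [det2]
  have nf := lpos_asymm f
  rcases h with h | ⟨h | h, h3⟩
  · tauto
  · tauto
  · by_contra hcon
    push Not at hcon
    have t := lpos_trans (a := -f) (b := -v) (v := d) h.1 h.2 hd
      (by rw [neg_neg_det]; linarith) (by rw [det2_neg_left]; linarith)
    rw [det2_neg_left] at t
    linarith

/-- A negative-to-positive transition is a lexicographic minimum. -/
lemma trans_min {f g d : ℝ × ℝ} (hf : lpos (-f)) (hg : lpos g) (hfg : det2 f g < 0)
    (h1 : det2 f d ≤ 0) (h2 : det2 g d ≤ 0) : ¬ lpos (-d) := by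
  intro hd
  have t := lpos_trans (a := -d) (b := g) (v := -f) hd hg hf
    (by rw [det2_neg_left, det2_comm d g]; linarith)
    (by rw [det2_neg_right, det2_comm g f]; linarith)
  rw [neg_neg_det, det2_comm] at t
  linarith

lemma alt_split (e f : ℝ × ℝ) (he : e ≠ 0) (hf : f ≠ 0) :
    (open Classical in if alt f e then det2 e f else 0) =
      det2 e f + (open Classical in if alt e f then det2 f e else 0) := by
  have ne := lpos_asymm e
  have nf := lpos_asymm f
  have c := det2_comm e f
  have key : (alt f e ∧ ¬ alt e f) ∨ (¬ alt f e ∧ alt e f) ∨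
      (¬ alt f e ∧ ¬ alt e f ∧ det2 e f = 0) := by
    unfold alt
    rcases lpos_or e he with h1 | h1 <;> rcases lpos_or f hf with h2 | h2
    · rcases lt_trichotomy (det2 e f) 0 with h | h | h
      · have : ¬ det2 f e < 0 := by linarith
        tauto
      · have : ¬ det2 f e < 0 := by linarith
        have : ¬ det2 e f < 0 := by linarith
        tauto
      · have : det2 f e < 0 := by linarith
        have : ¬ det2 e f < 0 := by linarith
        tauto
    · tauto
    · tauto
    · rcases lt_trichotomy (det2 e f) 0 with h | h | h
      · have : ¬ det2 f e < 0 := by linarith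
        tauto
      · have : ¬ det2 f e < 0 := by linarith
        have : ¬ det2 e f < 0 := by linarith
        tauto
      · have : det2 f e < 0 := by linarith
        have : ¬ det2 e f < 0 := by linarith
        tauto
  rcases key with h | h | h
  · simp [h.1, h.2]
  · simp only [h.1, h.2, if_true, if_false]; linarith
  · simp [h.1, h.2.1, h.2.2]

open Classical in
lemma core (B : Set (ℝ × ℝ)) (W : ℕ → ℝ × ℝ) (n : ℕ) (hn : 0 < n) (hper : W n = W 0)
    (hne : ∀ k, W (k + 1) - W k ≠ 0) (hinj : ∀ k, 0 < k → k < n → W k ≠ W 0)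
    (hcw : ∀ k, ∀ q ∈ B, det2 (W (k + 1) - W k) (q - W k) ≤ 0)
    (hW : ∀ k, W k ∈ B)
    (hline : ∀ f : ℝ × ℝ, f ≠ 0 → ∀ w, ∃ q ∈ B, det2 f (q - w) ≠ 0)
    (hmin : ∀ q ∈ B, q - W 0 = 0 ∨ lpos (q - W 0)) (v : ℝ × ℝ) (hv : v ≠ 0) :
    ∃ w ∈ B, (∀ q ∈ B, det2 v q ≤ det2 v w) ∧
      det2 v w = det2 v (W 0) + ∑ k ∈ Finset.range n,
        if alt (W (k + 1) - W k) v then det2 v (W (k + 1) - W k) else 0 := by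
  -- support at the end of an edge
  have hcw' : ∀ k, ∀ q ∈ B, det2 (W (k + 1) - W k) (q - W (k + 1)) ≤ 0 := by
    intro k q hq
    have := hcw k q hq
    simp only [det2, Prod.fst_sub, Prod.snd_sub] at *
    linarith
  have hdet : ∀ k, det2 (W (k + 1) - W k) (W (k + 1 + 1) - W (k + 1)) ≤ 0 :=
    fun k => hcw' k _ (hW _)
  have hopp : ∀ k, (lpos (W (k + 1) - W k) ∧ lpos (-(W (k + 1 + 1) - W (k + 1)))) ∨
      (lpos (-(W (k + 1) - W k)) ∧ lpos (W (k + 1 + 1) - W (k + 1))) →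
      det2 (W (k + 1) - W k) (W (k + 1 + 1) - W (k + 1)) < 0 := by
    intro k hk
    refine lt_of_le_of_ne (hdet k) fun h0 => ?_
    obtain ⟨q, hq, hq0⟩ := hline _ (hne k) (W (k + 1))
    have q1 := hcw' k q hq
    have q2 := hcw (k + 1) q hq
    have q1' := lt_of_le_of_ne q1 hq0
    generalize W (k + 1) - W k = f at *
    generalize W (k + 1 + 1) - W (k + 1) = g at *
    generalize q - W (k + 1) = d at *
    -- det f d • g = det g d • f  (as det f g = 0)
    have key : (-det2 f d) • g = (-det2 g d) • f := by
      have e : det2 f g • d = det2 f d • g - det2 g d • f := by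
        ext <;> simp [det2] <;> ring
      rw [h0, zero_smul] at e
      rw [neg_smul, neg_smul]
      have := sub_eq_zero.mp e.symm
      rw [this]
    have h1 : 0 < -det2 f d := by linarith
    have h2 : 0 ≤ -det2 g d := by linarith
    rcases hk with ⟨a, b⟩ | ⟨a, b⟩
    · have p := lpos_smul h1 b
      rw [smul_neg, key] at p
      rcases h2.lt_or_eq with h2 | h2
      · exact lpos_asymm _ (lpos_smul h2 a) p
      · rw [← h2] at p; exact lpos_ne _ p (by simp)
    · have p := lpos_smul h1 b
      rw [key] at p
      rcases h2.lt_or_eq with h2 | h2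
      · have p' := lpos_smul h2 a
        rw [smul_neg] at p'
        exact lpos_asymm _ p p'
      · rw [← h2] at p; exact lpos_ne _ p (by simp)
  have hale : ∀ k, k + 1 < n → ale (W (k + 1) - W k) (W (k + 1 + 1) - W (k + 1)) := by
    intro k hk
    refine ⟨hdet k, ?_⟩
    rcases lpos_or _ (hne k) with h1 | h1 <;> rcases lpos_or _ (hne (k + 1)) with h2 | h2
    · exact Or.inl ⟨h1, h2⟩
    · exact Or.inr (Or.inr ⟨h1, h2, hopp k (Or.inl ⟨h1, h2⟩)⟩)
    · exfalso
      have t := trans_min h1 h2 (hopp k (Or.inr ⟨h1, h2⟩)) (hcw' k _ (hW 0)) (hcw (k + 1) _ (hW 0))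
      rw [neg_sub] at t
      rcases hmin _ (hW (k + 1)) with h | h
      · exact hinj (k + 1) (by omega) hk (sub_eq_zero.mp h)
      · exact t h
    · exact Or.inr (Or.inl ⟨h1, h2⟩)
  have hf0 : lpos (W (0 + 1) - W 0) := (hmin _ (hW _)).resolve_left (hne 0)
  obtain ⟨N, rfl⟩ : ∃ N, n = N + 1 := ⟨n - 1, by omega⟩
  have hfl : lpos (-(W (N + 1) - W N)) := by
    rw [hper, neg_sub]
    refine (hmin _ (hW _)).resolve_left fun h => hne N ?_
    rw [hper, ← neg_sub, h, neg_zero]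
  obtain ⟨m, hm, hseg⟩ : ∃ m, m ≤ N + 1 ∧ ∀ k < N + 1, (alt (W (k + 1) - W k) v ↔ k < m) := by
    have : ∀ M, M ≤ N + 1 → ∃ m, m ≤ M ∧ ∀ k < M, (alt (W (k + 1) - W k) v ↔ k < m) := by
      intro M
      induction M with
      | zero => intro _; exact ⟨0, le_rfl, by simp⟩
      | succ M ih =>
        intro hM
        obtain ⟨m, hm, h⟩ := ih (by omega)
        by_cases hc : alt (W (M + 1) - W M) v
        · refine ⟨M + 1, le_rfl, fun k hk => iff_of_true ?_ hk⟩
          have : ∀ j, j ≤ M → alt (W (M - j + 1) - W (M - j)) v := by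
            intro j
            induction j with
            | zero => intro _; exact hc
            | succ j ihj =>
              intro hj
              have a := ihj (by omega)
              obtain ⟨r, hr⟩ : ∃ r, M - j = r + 1 := ⟨M - j - 1, by omega⟩
              have hr' : M - (j + 1) = r := by omega
              rw [hr] at a
              rw [hr']
              exact ale_alt (hale r (by omega)) a
          have := this (M - k) (by omega)
          rwa [show M - (M - k) = k by omega] at this
        · refine ⟨m, by omega, fun k hk => ?_⟩
          rcases Nat.lt_succ_iff_lt_or_eq.mp hk with hk | rfl
          · exact h k hk
          · exact iff_of_false hc (by omega)
    exact this _ le_rfl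
  refine ⟨W m, hW m, fun q hq => ?_, ?_⟩
  · suffices det2 v (q - W m) ≤ 0 by rw [det2_sub_right] at this; linarith
    rcases Nat.eq_zero_or_pos m with rfl | hm0
    · exact first hv hf0 (fun h => by simpa using (hseg 0 (by omega)).mp h) (hmin q hq) (hcw 0 q hq)
    · rcases hm.eq_or_lt with rfl | hm1
      · have a := (hseg N (by omega)).mpr (by omega)
        have b := hcw' N q hq
        rw [hper] at b ⊢
        exact last hfl a (hmin q hq) (by rwa [hper])
      · obtain ⟨r, rfl⟩ : ∃ r, m = r + 1 := ⟨m - 1, by omega⟩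
        exact mid hv (hale r hm1) ((hseg r (by omega)).mpr (by omega))
          (fun h => by simpa using (hseg (r + 1) hm1).mp h) (hcw' r q hq) (hcw (r + 1) q hq)
  · have s1 : ∑ k ∈ Finset.range (N + 1),
        (if alt (W (k + 1) - W k) v then det2 v (W (k + 1) - W k) else 0) =
        ∑ k ∈ Finset.range m, (det2 v (W (k + 1)) - det2 v (W k)) := by
      have : Finset.range m ⊆ Finset.range (N + 1) := Finset.range_subset_range.mpr hm
      rw [← Finset.sum_subset this (f := fun k =>
        if alt (W (k + 1) - W k) v then det2 v (W (k + 1) - W k) else 0)]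
      · refine Finset.sum_congr rfl fun k hk => ?_
        have hk' := Finset.mem_range.mp hk
        rw [if_pos ((hseg k (by omega)).mpr hk'), det2_sub_right]
      · intro k hk hk'
        rw [if_neg]
        rw [hseg k (Finset.mem_range.mp hk)]
        simpa using hk'
    rw [s1, Finset.sum_range_sub (fun k => det2 v (W k))]
    ring

lemma line_of_interior {B : Set (ℝ × ℝ)} (h : (interior B).Nonempty) (f : ℝ × ℝ) (hf : f ≠ 0)
    (w : ℝ × ℝ) : ∃ q ∈ B, det2 f (q - w) ≠ 0 := by
  obtain ⟨p, hp⟩ := h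
  by_contra hc
  push Not at hc
  have hcont : Continuous (fun s : ℝ => p + s • ((-f.2, f.1) : ℝ × ℝ)) := by fun_prop
  have hnb : (fun s : ℝ => p + s • ((-f.2, f.1) : ℝ × ℝ)) ⁻¹' (interior B) ∈ nhds (0 : ℝ) :=
    (isOpen_interior.preimage hcont).mem_nhds (by
      change p + (0 : ℝ) • ((-f.2, f.1) : ℝ × ℝ) ∈ interior B
      rw [zero_smul, add_zero]; exact hp)
  obtain ⟨ε, hε, hb⟩ := Metric.mem_nhds_iff.mp hnb
  have h1 : ε / 2 ∈ Metric.ball (0 : ℝ) ε := by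
    simp [abs_of_pos hε]; linarith
  have h2 := hc _ (interior_subset (hb h1))
  have h3 := hc _ (interior_subset hp)
  simp only [det2, Prod.fst_sub, Prod.snd_sub, Prod.fst_add, Prod.snd_add, Prod.smul_fst,
    Prod.smul_snd, smul_eq_mul] at h2 h3
  have h4 : ε / 2 * (f.1 ^ 2 + f.2 ^ 2) = 0 := by linarith
  have h5 : f.1 ^ 2 + f.2 ^ 2 = 0 := by
    rcases mul_eq_zero.mp h4 with h | h
    · linarith
    · exact h
  have h6 : f.1 = 0 := by nlinarith [sq_nonneg f.1, sq_nonneg f.2]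
  have h7 : f.2 = 0 := by nlinarith [sq_nonneg f.1, sq_nonneg f.2]
  exact hf (Prod.ext h6 h7)

lemma verts_mod (P : ClockPolygon) (i : ℕ) : P.verts (i % P.n) = P.verts i :=
  Function.Periodic.map_mod_nat (f := P.verts) P.periodic i

lemma verts_inj (P : ClockPolygon) (i j : ℕ) (h : P.verts i = P.verts j) : i % P.n = j % P.n := by
  rw [← verts_mod P i, ← verts_mod P j] at h
  exact P.inj _ _ (Nat.mod_lt _ P.npos) (Nat.mod_lt _ P.npos) h

lemma n_ne_one (P : ClockPolygon) (h : (interior P.body).Nonempty) : P.n ≠ 1 := by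
  intro h1
  have : Set.range P.verts ⊆ {P.verts 0} := by
    rintro _ ⟨i, rfl⟩
    rw [← verts_mod P i, h1, Nat.mod_one]; rfl
  have h2 : P.body ⊆ {P.verts 0} := convexHull_min this (convex_singleton _)
  obtain ⟨q, hq, hq0⟩ := line_of_interior h (1, 0) (by simp) (P.verts 0)
  have := h2 hq
  rw [Set.mem_singleton_iff] at this
  subst this
  simp [det2] at hq0

lemma edge_ne (P : ClockPolygon) (h : (interior P.body).Nonempty) (i : ℕ) :
    P.verts (i + 1) - P.verts i ≠ 0 := by
  intro h0
  have h1 := verts_inj P _ _ (sub_eq_zero.mp h0)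
  have h2 : i + 1 ≡ i + 0 [MOD P.n] := h1
  have h3 : 1 ≡ 0 [MOD P.n] := Nat.ModEq.add_left_cancel' i h2
  have h4 := (Nat.modEq_zero_iff_dvd.mp h3)
  exact n_ne_one P h (Nat.dvd_one.mp h4)

lemma sum_shift (g : ℕ → ℝ) (n : ℕ) (hg : ∀ i, g (i + n) = g i) (s : ℕ) :
    ∑ k ∈ Finset.range n, g (s + k) = ∑ k ∈ Finset.range n, g k := by
  induction s with
  | zero => simp
  | succ s ih =>
    rw [← ih]
    have a := Finset.sum_range_succ (fun k => g (s + k)) n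
    have b := Finset.sum_range_succ' (fun k => g (s + k)) n
    have c : ∑ k ∈ Finset.range n, g (s + 1 + k) = ∑ k ∈ Finset.range n, g (s + (k + 1)) :=
      Finset.sum_congr rfl fun k _ => by congr 1; omega
    rw [c]
    have := hg s
    simp only [add_zero] at b
    linarith

lemma convex_lmin (w : ℝ × ℝ) : Convex ℝ {q : ℝ × ℝ | q - w = 0 ∨ lpos (q - w)} := by
  intro x hx y hy a b ha hb hab
  simp only [Set.mem_ofPred_eq] at *
  have e : a • x + b • y - w = a • (x - w) + b • (y - w) := by
    have : w = a • w + b • w := by rw [← add_smul, hab, one_smul]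
    nth_rewrite 1 [this]
    rw [smul_sub, smul_sub]; abel
  rw [e]
  have sm : ∀ (t : ℝ) (z : ℝ × ℝ), 0 ≤ t → (z = 0 ∨ lpos z) → (t • z = 0 ∨ lpos (t • z)) := by
    rintro t z ht (rfl | hz)
    · simp
    · rcases ht.eq_or_lt with rfl | ht
      · simp
      · exact Or.inr (lpos_smul ht hz)
  rcases sm a _ ha hx with h1 | h1 <;> rcases sm b _ hb hy with h2 | h2
  · left; rw [h1, h2, add_zero]
  · right; rwa [h1, zero_add]
  · right; rwa [h2, add_zero]
  · right; exact lpos_add h1 h2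

open Classical in
lemma omegaLen_formula (P : ClockPolygon) (h : (interior P.body).Nonempty) :
    ∃ w0 : ℝ × ℝ, ∀ v : ℝ × ℝ, v ≠ 0 → omegaLen P.body v = det2 v w0 +
      ∑ k ∈ Finset.range P.n, if alt (P.verts (k + 1) - P.verts k) v then
        det2 v (P.verts (k + 1) - P.verts k) else 0 := by
  obtain ⟨s, hs, hsmin⟩ := Finset.exists_min_image (Finset.range P.n)
    (fun i => toLex (P.verts i)) ⟨0, Finset.mem_range.mpr P.npos⟩
  have hs' := Finset.mem_range.mp hs
  have hmin : ∀ q ∈ P.body, q - P.verts s = 0 ∨ lpos (q - P.verts s) := by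
    apply convexHull_min _ (convex_lmin (P.verts s))
    rintro _ ⟨i, rfl⟩
    have := hsmin (i % P.n) (Finset.mem_range.mpr (Nat.mod_lt _ P.npos))
    rw [verts_mod, Prod.Lex.le_iff] at this
    simp only [ofLex_toLex] at this
    simp only [Set.mem_ofPred_eq, lpos, Prod.fst_sub, Prod.snd_sub, sub_pos]
    rcases this with h | ⟨h1, h2⟩
    · exact Or.inr (Or.inl h)
    · rcases h2.eq_or_lt with h2 | h2
      · left; rw [sub_eq_zero]; exact Prod.ext h1.symm h2.symm
      · right; right; exact ⟨by linarith, h2⟩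
  refine ⟨P.verts s, fun v hv => ?_⟩
  obtain ⟨w, hw, hmax, hform⟩ := core P.body (fun k => P.verts (s + k)) P.n P.npos
    (by simpa using P.periodic s) (fun k => edge_ne P h (s + k))
    (by
      intro k hk hkn he
      have h2 : s + k ≡ s + 0 [MOD P.n] := verts_inj P _ _ he
      have h3 : k ≡ 0 [MOD P.n] := Nat.ModEq.add_left_cancel' s h2
      exact absurd (Nat.le_of_dvd hk (Nat.modEq_zero_iff_dvd.mp h3)) (by omega))
    (fun k q hq => P.clockwise (s + k) q hq)
    (fun k => subset_convexHull ℝ _ ⟨_, rfl⟩)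
    (fun f hf w => line_of_interior h f hf w) (by simpa using hmin) v hv
  have hL : omegaLen P.body v = det2 v w := by
    apply IsGreatest.csSup_eq
    refine ⟨⟨w, hw, rfl⟩, ?_⟩
    rintro _ ⟨q, hq, rfl⟩
    exact hmax q hq
  rw [hL, hform]
  congr 1
  exact sum_shift (fun k => if alt (P.verts (k + 1) - P.verts k) v then
        det2 v (P.verts (k + 1) - P.verts k) else 0) P.n (by
      intro i
      have e : P.verts (i + P.n + 1) = P.verts (i + 1) := by
        rw [← P.periodic (i + 1)]; congr 1; omega
      simp only [e, P.periodic i]) s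

lemma sum_edges (P : ClockPolygon) (w : ℝ × ℝ) :
    ∑ i ∈ Finset.range P.n, det2 (P.verts (i + 1) - P.verts i) w = 0 := by
  simp only [det2_sub_left]
  rw [Finset.sum_range_sub (fun i => det2 (P.verts i) w)]
  have := P.periodic 0
  rw [zero_add] at this
  rw [this, sub_self]

/-- If every edge of `Λ` is parallel to an edge of `Ω`,
then `ℓ_Ω(∂Λ) = ℓ_Λ(∂Ω)`. -/
theorem omegaPerim_symm (PΩ PΛ : ClockPolygon)
    (hΩ : (interior PΩ.body).Nonempty) (hΛ : (interior PΛ.body).Nonempty)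
    (hpar : EdgesParallel PΛ PΩ) :
    omegaPerim PΩ.body PΛ = omegaPerim PΛ.body PΩ := by
  classical
  obtain ⟨a, ha⟩ := omegaLen_formula PΩ hΩ
  obtain ⟨b, hb⟩ := omegaLen_formula PΛ hΛ
  unfold omegaPerim
  rw [Finset.sum_congr rfl fun i _ => ha _ (edge_ne PΛ hΛ i),
    Finset.sum_congr rfl fun i _ => hb _ (edge_ne PΩ hΩ i),
    Finset.sum_add_distrib, Finset.sum_add_distrib, sum_edges, sum_edges, zero_add, zero_add]
  rw [Finset.sum_comm (s := Finset.range PΩ.n)]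
  rw [Finset.sum_congr rfl fun i _ => Finset.sum_congr rfl fun k _ =>
    alt_split _ _ (edge_ne PΛ hΛ i) (edge_ne PΩ hΩ k)]
  simp only [Finset.sum_add_distrib]
  rw [Finset.sum_comm]
  simp only [sum_edges, Finset.sum_const_zero, zero_add]

end
end

section
/- Let a and b be positive integers and let Ω := [0,a] × [0,b], so that X_Ω is the polydisk P(a,b). Then for every integer r ≥ 0, cap_{X_Ω}(2abr) = (ar + 1)(br + 1); that is, at arguments which are multiples of 2ab (twice the area of Ω), the cap function of the polydisk equals the Hilbert/Ehrhart-type product (ar+1)(br+1), the number of lattice points in the rectangle r·Ω. -/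
open scoped BigOperators Pointwise

noncomputable section

open Set in
lemma omegaLen_rect (a b : ℕ) (v : ℝ × ℝ) :
    omegaLen (Set.Icc (0 : ℝ) (a : ℝ) ×ˢ Set.Icc (0 : ℝ) (b : ℝ)) v
      = b * max v.1 0 + a * max (-v.2) 0 := by
  have ha : (0:ℝ) ≤ a := Nat.cast_nonneg a
  have hb : (0:ℝ) ≤ b := Nat.cast_nonneg b
  apply IsGreatest.csSup_eq
  constructor
  · refine ⟨(if 0 ≤ -v.2 then (a:ℝ) else 0, if 0 ≤ v.1 then (b:ℝ) else 0), ?_, ?_⟩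
    · simp only [Set.mem_prod, Set.mem_Icc]
      split_ifs <;> simp [ha, hb]
    · simp only [det2]
      split_ifs with h1 h2 h2
      · rw [max_eq_left h1, max_eq_left h2]; ring
      · rw [max_eq_left h1, max_eq_right (by linarith)]; ring
      · rw [max_eq_right (by linarith : v.1 ≤ 0), max_eq_left h2]; ring
      · rw [max_eq_right (by linarith : -v.2 ≤ 0), max_eq_right (by linarith)]; ring
  · rintro _ ⟨p, hp, rfl⟩
    simp only [Set.mem_prod, Set.mem_Icc] at hp
    obtain ⟨⟨h1, h2⟩, h3, h4⟩ := hp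
    have e1 : v.1 * p.2 ≤ max v.1 0 * b :=
      (mul_le_mul_of_nonneg_right (le_max_left _ _) h3).trans
        (mul_le_mul_of_nonneg_left h4 (le_max_right _ _))
    have e2 : (-v.2) * p.1 ≤ max (-v.2) 0 * a :=
      (mul_le_mul_of_nonneg_right (le_max_left _ _) h1).trans
        (mul_le_mul_of_nonneg_left h2 (le_max_right _ _))
    simp only [det2]; linarith

lemma cyc_sum_ge (n : ℕ) (f : ℕ → ℝ) (hf : f n = f 0) (i j : ℕ) (hi : i < n) (hj : j < n) :
    f i - f j ≤ ∑ k ∈ Finset.range n, max (f (k + 1) - f k) 0 := by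
  set S : ℕ → ℝ := fun m => ∑ k ∈ Finset.range m, max (f (k + 1) - f k) 0 with hS
  have hS1 : Monotone S := by
    apply monotone_nat_of_le_succ
    intro m
    simp only [hS, Finset.sum_range_succ]
    linarith [le_max_right (f (m + 1) - f m) 0]
  have hS2 : Monotone (fun m => S m - f m) := by
    apply monotone_nat_of_le_succ
    intro m
    simp only [hS, Finset.sum_range_succ]
    linarith [le_max_left (f (m + 1) - f m) 0]
  have h0 : S 0 = 0 := by simp [hS]
  change f i - f j ≤ S n
  rcases le_total j i with h | h
  · have q1 := hS2 h
    have q2 := hS1 hi.le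
    have q3 := hS1 (Nat.zero_le j)
    simp only at q1
    linarith
  · have q1 := hS2 (Nat.zero_le i)
    have q2 := hS2 hj.le
    have q3 := hS1 h
    simp only at q1 q2
    linarith

lemma arith_bound (a b r X Y : ℕ) (ha : 0 < a) (hb : 0 < b)
    (h : b * X + a * Y ≤ 2 * a * b * r) : (X + 1) * (Y + 1) ≤ (a * r + 1) * (b * r + 1) := by
  by_cases hc : X ≤ a * r ∧ Y ≤ b * r
  · exact Nat.mul_le_mul (by omega) (by omega)
  have hc' : (a * r : ℤ) < X ∨ (b * r : ℤ) < Y := by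
    by_contra h3
    push Not at h3
    exact hc ⟨by exact_mod_cast h3.1, by exact_mod_cast h3.2⟩
  clear hc
  zify at *
  generalize (X : ℤ) = x at *
  generalize (Y : ℤ) = y at *
  generalize (a : ℤ) = a at *
  generalize (b : ℤ) = b at *
  have hr : (0:ℤ) ≤ r := Int.natCast_nonneg r
  generalize (r : ℤ) = r at *
  obtain ⟨s, rfl⟩ : ∃ s, x = a * r + s := ⟨x - a * r, by ring⟩
  obtain ⟨t, rfl⟩ : ∃ t, y = b * r + t := ⟨y - b * r, by ring⟩
  have h' : b * s + a * t ≤ 0 := by linarith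
  have h2 : r * (b * s + a * t) ≤ 0 := mul_nonpos_of_nonneg_of_nonpos hr h'
  have key : s + t + s * t ≤ 0 := by
    rcases hc' with hs | ht
    · have hs : 0 < s := by linarith
      have : t < 0 := by
        by_contra hc; push Not at hc; nlinarith [mul_nonneg ha.le hc, mul_pos hb hs]
      nlinarith
    · have ht : 0 < t := by linarith
      have : s < 0 := by
        by_contra hc; push Not at hc; nlinarith [mul_nonneg hb.le hc, mul_pos ha ht]
      nlinarith
  nlinarith

/-- Build a clockwise polygon from a finite list of vertices. -/
def mkPoly (n : ℕ) (hn : 0 < n) (f : ℕ → ℝ × ℝ)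
    (hinj : ∀ i j, i < n → j < n → f i = f j → i = j)
    (hcw : ∀ i j, i < n → j < n → det2 (f ((i + 1) % n) - f i) (f j - f i) ≤ 0) :
    ClockPolygon where
  n := n
  npos := hn
  verts := fun i => f (i % n)
  periodic := fun i => by simp
  inj := fun i j hi hj h => by
    rw [Nat.mod_eq_of_lt hi, Nat.mod_eq_of_lt hj] at h
    exact hinj i j hi hj h
  clockwise := by
    intro i
    have hsub : convexHull ℝ (Set.range fun i => f (i % n)) ⊆
        {q | det2 (f ((i + 1) % n) - f (i % n)) (q - f (i % n)) ≤ 0} := by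
      apply convexHull_min
      · rintro _ ⟨j, rfl⟩
        have := hcw (i % n) (j % n) (Nat.mod_lt _ hn) (Nat.mod_lt _ hn)
        rwa [Nat.mod_add_mod] at this
      · intro p hp q hq u v hu hv huv
        simp only [det2, Set.mem_ofPred_eq, Prod.fst_sub, Prod.snd_sub, Prod.fst_add, Prod.snd_add,
          Prod.smul_fst, Prod.smul_snd, smul_eq_mul] at hp hq ⊢
        generalize f (i % n) = c at *
        generalize f ((i + 1) % n) = d at *
        have hv' : v = 1 - u := by linarith
        subst hv'
        have e1 := mul_nonpos_of_nonneg_of_nonpos hu hp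
        have e2 := mul_nonpos_of_nonneg_of_nonpos hv hq
        linarith
    exact fun q hq => hsub hq

lemma mkPoly_range (n hn f hinj hcw) :
    Set.range (mkPoly n hn f hinj hcw).verts = f '' Set.Iio n := by
  ext p
  constructor
  · rintro ⟨i, rfl⟩
    exact ⟨i % n, Nat.mod_lt _ hn, rfl⟩
  · rintro ⟨i, hi, rfl⟩
    exact ⟨i, by simp [mkPoly, Nat.mod_eq_of_lt (Set.mem_Iio.1 hi)]⟩

lemma mkPoly_perim (Ω) (n hn f hinj hcw) :
    omegaPerim Ω (mkPoly n hn f hinj hcw)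
      = ∑ i ∈ Finset.range n, omegaLen Ω (f ((i + 1) % n) - f i) := by
  apply Finset.sum_congr rfl
  intro i hi
  simp only [mkPoly]
  rw [Nat.mod_eq_of_lt (Finset.mem_range.1 hi : i < n)]

/-- Main lower bound. -/
lemma perim_lower (a b : ℕ) (ha : 0 < a) (hb : 0 < b) (r k : ℕ) (P : ClockPolygon)
    (hP : IsCompetitor P) (hk : latticeCount P.body = k + 1)
    (hN : (a * r + 1) * (b * r + 1) < k + 1) :
    ((2 * a * b * r : ℕ) : ℝ) + 1 ≤
      omegaPerim (Set.Icc (0 : ℝ) (a : ℝ) ×ˢ Set.Icc (0 : ℝ) (b : ℝ)) P := by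
  obtain ⟨hlat, hpos, h0, -⟩ := hP
  have hmod : ∀ i, P.verts i = P.verts (i % P.n) := by
    intro i
    have : Function.Periodic P.verts P.n := P.periodic
    exact (this.map_mod_nat i).symm
  have hne : (Finset.range P.n).Nonempty := ⟨0, Finset.mem_range.2 P.npos⟩
  -- maximal vertices
  obtain ⟨i1, hi1, hmax1⟩ := Finset.exists_max_image (Finset.range P.n)
    (fun i => (P.verts i).1) hne
  obtain ⟨i2, hi2, hmax2⟩ := Finset.exists_max_image (Finset.range P.n)
    (fun i => (P.verts i).2) hne
  obtain ⟨j1, hj1, hmin1⟩ := Finset.exists_min_image (Finset.range P.n)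
    (fun i => (P.verts i).1) hne
  obtain ⟨j2, hj2, hmin2⟩ := Finset.exists_min_image (Finset.range P.n)
    (fun i => (P.verts i).2) hne
  have hall1 : ∀ i, (P.verts j1).1 ≤ (P.verts i).1 ∧ (P.verts i).1 ≤ (P.verts i1).1 := by
    intro i
    rw [hmod i]
    have : i % P.n ∈ Finset.range P.n := Finset.mem_range.2 (Nat.mod_lt _ P.npos)
    exact ⟨hmin1 _ this, hmax1 _ this⟩
  have hall2 : ∀ i, (P.verts j2).2 ≤ (P.verts i).2 ∧ (P.verts i).2 ≤ (P.verts i2).2 := by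
    intro i
    rw [hmod i]
    have : i % P.n ∈ Finset.range P.n := Finset.mem_range.2 (Nat.mod_lt _ P.npos)
    exact ⟨hmin2 _ this, hmax2 _ this⟩
  have hbox : P.body ⊆ Set.Icc (P.verts j1).1 (P.verts i1).1 ×ˢ
      Set.Icc (P.verts j2).2 (P.verts i2).2 := by
    apply convexHull_min
    · rintro _ ⟨i, rfl⟩
      exact ⟨hall1 i, hall2 i⟩
    · exact (convex_Icc _ _).prod (convex_Icc _ _)
  have h00 := hbox h0
  simp only [Set.mem_prod, Set.mem_Icc] at h00
  obtain ⟨m1, hm1⟩ := (hlat i1).1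
  obtain ⟨m2, hm2⟩ := (hlat i2).2
  have p1 := (hpos i1).1
  have p2 := (hpos i2).2
  rw [hm1] at p1
  rw [hm2] at p2
  obtain ⟨X, rfl⟩ := Int.eq_ofNat_of_zero_le (by exact_mod_cast p1 : (0:ℤ) ≤ m1)
  obtain ⟨Y, rfl⟩ := Int.eq_ofNat_of_zero_le (by exact_mod_cast p2 : (0:ℤ) ≤ m2)
  have hcount : k + 1 ≤ (X + 1) * (Y + 1) := by
    rw [← hk]
    have hsub : {p ∈ P.body | IsLatticePt p} ⊆
        (((Finset.range (X + 1)) ×ˢ (Finset.range (Y + 1))).image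
          (fun p : ℕ × ℕ => ((p.1 : ℝ), (p.2 : ℝ))) : Finset (ℝ × ℝ)) := by
      rintro ⟨x, y⟩ ⟨hq, ⟨u, hu⟩, ⟨v, hv⟩⟩
      have hq := hbox hq
      simp only [Set.mem_prod, Set.mem_Icc] at hq hu hv
      subst hu hv
      have g1 : (0:ℝ) ≤ u := (hpos j1).1.trans hq.1.1
      have g2 : (0:ℝ) ≤ v := (hpos j2).2.trans hq.2.1
      obtain ⟨u, rfl⟩ := Int.eq_ofNat_of_zero_le (by exact_mod_cast g1 : (0:ℤ) ≤ u)
      obtain ⟨v, rfl⟩ := Int.eq_ofNat_of_zero_le (by exact_mod_cast g2 : (0:ℤ) ≤ v)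
      have g3 := hq.1.2
      have g4 := hq.2.2
      rw [hm1] at g3
      rw [hm2] at g4
      have g3 : u ≤ X := by exact_mod_cast g3
      have g4 : v ≤ Y := by exact_mod_cast g4
      simp only [Finset.coe_image, Set.mem_image]
      exact ⟨(u, v), by simp; omega, by simp⟩
    calc latticeCount P.body ≤ _ := Set.ncard_le_ncard hsub (Finset.finite_toSet _)
      _ ≤ _ := by
        rw [Set.ncard_coe_finset]
        exact Finset.card_image_le.trans (by simp)
  have hXY : 2 * a * b * r + 1 ≤ b * X + a * Y := by
    by_contra hc
    have := arith_bound a b r X Y ha hb (by omega)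
    omega
  have hXY' : ((2 * a * b * r : ℕ) : ℝ) + 1 ≤ b * X + a * Y := by exact_mod_cast hXY
  refine hXY'.trans ?_
  have c1 := cyc_sum_ge P.n (fun i => (P.verts i).1) (by
    have := P.periodic 0; simp only [zero_add] at this; simp [this]) i1 j1
    (Finset.mem_range.1 hi1) (Finset.mem_range.1 hj1)
  have c2 := cyc_sum_ge P.n (fun i => -(P.verts i).2) (by
    have := P.periodic 0; simp only [zero_add] at this; simp [this]) j2 i2
    (Finset.mem_range.1 hj2) (Finset.mem_range.1 hi2)
  simp only [omegaPerim, omegaLen_rect, Finset.sum_add_distrib, ← Finset.mul_sum]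
  rw [hm1] at c1
  rw [hm2] at c2
  have d1 : (X:ℝ) ≤ ∑ k ∈ Finset.range P.n, max ((P.verts (k + 1)).1 - (P.verts k).1) 0 := by
    push_cast at c1; linarith [h00.1.1]
  have d2 : (Y:ℝ) ≤ ∑ k ∈ Finset.range P.n, max (-((P.verts (k + 1)).2 - (P.verts k).2)) 0 := by
    have e : ∀ k, -((P.verts (k + 1)).2 - (P.verts k).2) = -(P.verts (k+1)).2 - -(P.verts k).2 :=
      fun k => by ring
    simp only [e]
    push_cast at c2; linarith [h00.2.1]
  simp only [Prod.fst_sub, Prod.snd_sub]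
  gcongr

/-- Segment polygons. -/
lemma exists_seg (a b k : ℕ) : ∃ P : ClockPolygon, IsCompetitor P ∧
    latticeCount P.body = k + 1 ∧
    omegaPerim (Set.Icc (0 : ℝ) (a : ℝ) ×ˢ Set.Icc (0 : ℝ) (b : ℝ)) P = b * k := by
  have hP : ∃ P : ClockPolygon, Set.range P.verts = {((0:ℝ), (0:ℝ)), ((k:ℝ), (0:ℝ))} ∧
      omegaPerim (Set.Icc (0 : ℝ) (a : ℝ) ×ˢ Set.Icc (0 : ℝ) (b : ℝ)) P = b * k := by
    rcases Nat.eq_zero_or_pos k with rfl | hk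
    · refine ⟨mkPoly 1 (by norm_num) (fun _ => (0, 0)) (by intros; omega)
        (by intros; simp [det2]), ?_, ?_⟩
      · rw [mkPoly_range]; ext p; simp
      · rw [mkPoly_perim]; simp only [omegaLen_rect]; simp
    · have hk' : (0:ℝ) < k := by exact_mod_cast hk
      refine ⟨mkPoly 2 (by norm_num) (fun i => if i = 0 then (0, 0) else ((k:ℝ), 0)) ?_ ?_, ?_, ?_⟩
      · intro i j hi hj h
        interval_cases i <;> interval_cases j <;> simp at h ⊢ <;> first | omega | linarith
      · intro i j hi hj
        interval_cases i <;> interval_cases j <;> simp [det2]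
      · rw [mkPoly_range]
        ext p
        constructor
        · rintro ⟨i, hi, rfl⟩
          simp only [Set.mem_Iio] at hi
          interval_cases i <;> simp
        · rintro (rfl | rfl)
          · exact ⟨0, by simp, by simp⟩
          · exact ⟨1, by simp, by simp⟩
      · rw [mkPoly_perim]
        simp only [omegaLen_rect]
        simp [Finset.sum_range_succ]
  obtain ⟨P, hr, hp⟩ := hP
  have hk0 : (0:ℝ) ≤ k := Nat.cast_nonneg k
  have hbody : P.body = {p : ℝ × ℝ | 0 ≤ p.1 ∧ p.1 ≤ k ∧ p.2 = 0} := by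
    rw [ClockPolygon.body, hr]
    apply Set.Subset.antisymm
    · apply convexHull_min
      · rintro p (rfl | rfl) <;> simp
      · rintro p ⟨h1, h2, h3⟩ q ⟨g1, g2, g3⟩ u v hu hv huv
        refine ⟨?_, ?_, ?_⟩ <;>
          simp only [Prod.fst_add, Prod.snd_add, Prod.smul_fst, Prod.smul_snd, smul_eq_mul]
        · positivity
        · have hv' : v = 1 - u := by linarith
          subst hv'
          nlinarith
        · rw [h3, g3]; simp
    · rintro ⟨x, y⟩ ⟨h1, h2, h3⟩
      simp only at h1 h2 h3
      subst h3
      rw [convexHull_pair]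
      rcases hk0.eq_or_lt with h | h
      · have : x = 0 := by linarith
        rw [this]; exact left_mem_segment _ _ _
      · rw [segment_eq_image]
        refine ⟨x / k, ⟨by positivity, by rw [div_le_one h]; exact h2⟩, ?_⟩
        ext <;> simp
        field_simp
  have hmem : ∀ i, P.verts i = (0, 0) ∨ P.verts i = ((k:ℝ), 0) := by
    intro i
    have : P.verts i ∈ Set.range P.verts := ⟨i, rfl⟩
    rw [hr] at this
    exact this
  refine ⟨P, ⟨?_, ?_, ?_, ?_⟩, ?_, hp⟩
  · intro i
    rcases hmem i with h | h <;> rw [h]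
    · exact ⟨⟨0, by simp⟩, ⟨0, by simp⟩⟩
    · exact ⟨⟨k, by simp⟩, ⟨0, by simp⟩⟩
  · intro i
    rcases hmem i with h | h <;> rw [h] <;> simp
  · rw [hbody]; simp
  · rw [hbody]
    rintro ⟨x, y⟩ ⟨h1, h2, h3⟩ ⟨x', y'⟩ ⟨⟨g1, g2⟩, g3, g4⟩
    simp only at *
    exact ⟨g1, by linarith, by linarith⟩
  · have : {p ∈ P.body | IsLatticePt p} =
        (fun i : ℕ => ((i:ℝ), (0:ℝ))) '' (Finset.range (k + 1) : Set ℕ) := by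
      rw [hbody]
      ext ⟨x, y⟩
      constructor
      · rintro ⟨⟨h1, h2, h3⟩, ⟨u, hu⟩, -⟩
        simp only at h1 h2 h3 hu
        subst hu h3
        obtain ⟨u, rfl⟩ := Int.eq_ofNat_of_zero_le (by exact_mod_cast h1 : (0:ℤ) ≤ u)
        have : u ≤ k := by exact_mod_cast h2
        exact ⟨u, by simp; omega, by simp⟩
      · rintro ⟨u, hu, h⟩
        simp only [Prod.mk.injEq] at h
        obtain ⟨rfl, rfl⟩ := h
        simp only [Finset.coe_range, Set.mem_Iio] at hu
        exact ⟨⟨by simp, by simp; omega, rfl⟩, ⟨u, by simp⟩, ⟨0, by simp⟩⟩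
    rw [latticeCount, this, Set.ncard_image_of_injective, Set.ncard_coe_finset, Finset.card_range]
    intro u v h
    simpa using h

/-- Five-vertex polygons, allowing repeated vertices. -/
lemma exists_pent (a b A Y j : ℕ) (hA : 0 < A) (hY : 0 < Y) (hj : j ≤ A) :
    ∃ P : ClockPolygon, Set.range P.verts =
        {((0:ℝ), (0:ℝ)), ((0:ℝ), (Y:ℝ)), ((j:ℝ), (Y:ℝ)), ((A:ℝ), (Y:ℝ) - 1), ((A:ℝ), (0:ℝ))} ∧
      omegaPerim (Set.Icc (0 : ℝ) (a : ℝ) ×ˢ Set.Icc (0 : ℝ) (b : ℝ)) P = b * A + a * Y := by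
  have hA' : (0:ℝ) < A := by exact_mod_cast hA
  have hY' : (0:ℝ) ≤ (Y:ℝ) - 1 := by
    have : (1:ℝ) ≤ Y := by exact_mod_cast hY
    linarith
  have hj' : (j:ℝ) ≤ A := by exact_mod_cast hj
  have hj0 : (0:ℝ) ≤ j := Nat.cast_nonneg j
  have hY1 : Y = 1 ∨ (0:ℝ) < (Y:ℝ) - 1 := by
    rcases Nat.lt_or_ge 1 Y with h | h
    · right
      have : (1:ℝ) < Y := by exact_mod_cast h
      linarith
    · left; omega
  have hj1 : j = 0 ∨ (0:ℝ) < j ∧ 0 < j := by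
    rcases Nat.eq_zero_or_pos j with h | h
    · left; exact h
    · right; exact ⟨by exact_mod_cast h, h⟩
  clear hj hY
  rcases hj1 with rfl | ⟨hj1, hjn⟩ <;> rcases hY1 with rfl | hY1
  · refine ⟨mkPoly 3 (by norm_num) (fun i => match i with
      | 0 => (0, 0)
      | 1 => (0, 1)
      | _ => ((A:ℝ), 0)) ?_ ?_, ?_, ?_⟩
    · intro i j hi hj h
      interval_cases i <;> interval_cases j <;> simp at h ⊢ <;> first | linarith | omega
    · intro i j hi hj
      interval_cases i <;> interval_cases j <;> simp [det2]
    · rw [mkPoly_range]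
      ext p
      constructor
      · rintro ⟨i, hi, rfl⟩
        simp only [Set.mem_Iio] at hi
        interval_cases i <;> simp
      · rintro (rfl | rfl | rfl | rfl | rfl)
        · exact ⟨0, by simp, by simp⟩
        · exact ⟨1, by simp, by simp⟩
        · exact ⟨1, by simp, by simp⟩
        · exact ⟨2, by simp, by simp⟩
        · exact ⟨2, by simp, by simp⟩
    · rw [mkPoly_perim]
      simp only [omegaLen_rect]
      simp [Finset.sum_range_succ]
  · generalize hy : (Y:ℝ) = y at *
    refine ⟨mkPoly 4 (by norm_num) (fun i => match i with
      | 0 => (0, 0)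
      | 1 => (0, y)
      | 2 => ((A:ℝ), y - 1)
      | _ => ((A:ℝ), 0)) ?_ ?_, ?_, ?_⟩
    · intro i j hi hj h
      interval_cases i <;> interval_cases j <;> simp at h ⊢ <;> first | linarith | omega
    · intro i j hi hj
      interval_cases i <;> interval_cases j <;> simp [det2] <;> nlinarith
    · rw [mkPoly_range]
      ext p
      constructor
      · rintro ⟨i, hi, rfl⟩
        simp only [Set.mem_Iio] at hi
        interval_cases i <;> simp
      · rintro (rfl | rfl | rfl | rfl | rfl)
        · exact ⟨0, by simp, by simp⟩
        · exact ⟨1, by simp, by simp⟩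
        · exact ⟨1, by simp, by simp⟩
        · exact ⟨2, by simp, by simp⟩
        · exact ⟨3, by simp, by simp⟩
    · rw [mkPoly_perim]
      simp only [omegaLen_rect]
      simp [Finset.sum_range_succ]
      rw [max_eq_right (by linarith : -y ≤ 0), max_eq_left (by linarith : 0 ≤ y - 1)]
      ring
  · refine ⟨mkPoly 4 (by norm_num) (fun i => match i with
      | 0 => (0, 0)
      | 1 => (0, 1)
      | 2 => ((j:ℝ), 1)
      | _ => ((A:ℝ), 0)) ?_ ?_, ?_, ?_⟩
    · intro i j hi hj h
      interval_cases i <;> interval_cases j <;> simp at h ⊢ <;> first | linarith | omega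
    · intro i j hi hj
      interval_cases i <;> interval_cases j <;> simp [det2] <;> nlinarith
    · rw [mkPoly_range]
      ext p
      constructor
      · rintro ⟨i, hi, rfl⟩
        simp only [Set.mem_Iio] at hi
        interval_cases i <;> simp
      · rintro (rfl | rfl | rfl | rfl | rfl)
        · exact ⟨0, by simp, by simp⟩
        · exact ⟨1, by simp, by simp⟩
        · exact ⟨2, by simp, by simp⟩
        · exact ⟨3, by simp, by simp⟩
        · exact ⟨3, by simp, by simp⟩
    · rw [mkPoly_perim]
      simp only [omegaLen_rect]
      simp [Finset.sum_range_succ]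
      rw [max_eq_left (by linarith : (0:ℝ) ≤ A - j)]
      ring
  · generalize hy : (Y:ℝ) = y at *
    refine ⟨mkPoly 5 (by norm_num) (fun i => match i with
      | 0 => (0, 0)
      | 1 => (0, y)
      | 2 => ((j:ℝ), y)
      | 3 => ((A:ℝ), y - 1)
      | _ => ((A:ℝ), 0)) ?_ ?_, ?_, ?_⟩
    · intro i j hi hj h
      interval_cases i <;> interval_cases j <;> simp at h ⊢ <;> first | linarith | omega
    · intro i k hi hk
      have q1 := mul_nonneg hY' (sub_nonneg.2 hj')
      have q2 := mul_nonneg hY' hj0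
      have q3 := mul_nonneg hY' hA'.le
      interval_cases i <;> interval_cases k <;> simp [det2] <;> nlinarith
    · rw [mkPoly_range]
      ext p
      constructor
      · rintro ⟨i, hi, rfl⟩
        simp only [Set.mem_Iio] at hi
        interval_cases i <;> simp
      · rintro (rfl | rfl | rfl | rfl | rfl)
        · exact ⟨0, by simp, by simp⟩
        · exact ⟨1, by simp, by simp⟩
        · exact ⟨2, by simp, by simp⟩
        · exact ⟨3, by simp, by simp⟩
        · exact ⟨4, by simp, by simp⟩
    · rw [mkPoly_perim]
      simp only [omegaLen_rect]
      simp [Finset.sum_range_succ]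
      rw [max_eq_right (by linarith : -y ≤ 0), max_eq_left (by linarith : 0 ≤ y - 1),
        max_eq_left (by linarith : (0:ℝ) ≤ A - j)]
      ring

/-- Horizontal segments inside convex sets. -/
lemma mem_hseg {C : Set (ℝ × ℝ)} (hC : Convex ℝ C) {x0 x1 x y : ℝ} (h0 : (x0, y) ∈ C)
    (h1 : (x1, y) ∈ C) (hx : x0 ≤ x) (hx' : x ≤ x1) : (x, y) ∈ C := by
  rcases (hx.trans hx').eq_or_lt with h | h
  · have : x = x0 := by linarith
    rwa [this]
  · have hd : 0 < x1 - x0 := by linarith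
    have := hC h0 h1 (a := (x1 - x) / (x1 - x0)) (b := (x - x0) / (x1 - x0))
      (div_nonneg (by linarith) hd.le) (div_nonneg (by linarith) hd.le)
      (by field_simp; ring)
    convert this using 1
    ext <;> simp <;> field_simp <;> ring

/-- Vertical segments inside convex sets. -/
lemma mem_vseg {C : Set (ℝ × ℝ)} (hC : Convex ℝ C) {y0 y1 x y : ℝ} (h0 : (x, y0) ∈ C)
    (h1 : (x, y1) ∈ C) (hx : y0 ≤ y) (hx' : y ≤ y1) : (x, y) ∈ C := by
  rcases (hx.trans hx').eq_or_lt with h | h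
  · have : y = y0 := by linarith
    rwa [this]
  · have hd : 0 < y1 - y0 := by linarith
    have := hC h0 h1 (a := (y1 - y) / (y1 - y0)) (b := (y - y0) / (y1 - y0))
      (div_nonneg (by linarith) hd.le) (div_nonneg (by linarith) hd.le)
      (by field_simp; ring)
    convert this using 1
    ext <;> simp <;> field_simp <;> ring

lemma exists_full (a b A Y j : ℕ) (hA : 0 < A) (hY : 0 < Y) (hj : j ≤ A) :
    ∃ P : ClockPolygon, IsCompetitor P ∧ latticeCount P.body = (A + 1) * Y + j + 1 ∧
      omegaPerim (Set.Icc (0 : ℝ) (a : ℝ) ×ˢ Set.Icc (0 : ℝ) (b : ℝ)) P = b * A + a * Y := by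
  obtain ⟨P, hr, hp⟩ := exists_pent a b A Y j hA hY hj
  have hY' : (0:ℝ) ≤ (Y:ℝ) - 1 := by
    have : (1:ℝ) ≤ Y := by exact_mod_cast hY
    linarith
  have hj' : (j:ℝ) ≤ A := by exact_mod_cast hj
  have hj0 : (0:ℝ) ≤ j := Nat.cast_nonneg j
  have hbody : P.body = {p : ℝ × ℝ | 0 ≤ p.1 ∧ 0 ≤ p.2 ∧ p.1 ≤ A ∧ p.2 ≤ Y ∧
      p.1 ≤ A - (p.2 - (Y - 1)) * (A - j)} := by
    rw [ClockPolygon.body, hr]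
    apply Set.Subset.antisymm
    · apply convexHull_min
      · have q1 := mul_nonneg hY' (sub_nonneg.2 hj')
        rintro p (rfl | rfl | rfl | rfl | rfl) <;> refine ⟨?_, ?_, ?_, ?_, ?_⟩ <;> simp only <;>
          nlinarith
      · rintro p ⟨h1, h2, h3, h4, h5⟩ q ⟨g1, g2, g3, g4, g5⟩ u v hu hv huv
        have hv' : v = 1 - u := by linarith
        subst hv'
        refine ⟨?_, ?_, ?_, ?_, ?_⟩ <;>
          simp only [Prod.fst_add, Prod.snd_add, Prod.smul_fst, Prod.smul_snd, smul_eq_mul]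
        · positivity
        · positivity
        · nlinarith
        · nlinarith
        · have e1 := mul_le_mul_of_nonneg_left h5 hu
          have e2 := mul_le_mul_of_nonneg_left g5 hv
          linarith
    · rintro ⟨x, y⟩ ⟨h1, h2, h3, h4, h5⟩
      simp only at h1 h2 h3 h4 h5
      set V : Set (ℝ × ℝ) :=
        {((0:ℝ), (0:ℝ)), ((0:ℝ), (Y:ℝ)), ((j:ℝ), (Y:ℝ)), ((A:ℝ), (Y:ℝ) - 1), ((A:ℝ), (0:ℝ))}
        with hV
      have hC : Convex ℝ (convexHull ℝ V) := convex_convexHull ℝ V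
      have hs := subset_convexHull ℝ V
      have v0 : ((0:ℝ), (0:ℝ)) ∈ convexHull ℝ V := hs (by simp [hV])
      have v1 : ((0:ℝ), (Y:ℝ)) ∈ convexHull ℝ V := hs (by simp [hV])
      have v2 : ((j:ℝ), (Y:ℝ)) ∈ convexHull ℝ V := hs (by simp [hV])
      have v3 : ((A:ℝ), (Y:ℝ) - 1) ∈ convexHull ℝ V := hs (by simp [hV])
      have v4 : ((A:ℝ), (0:ℝ)) ∈ convexHull ℝ V := hs (by simp [hV])
      have l := mem_vseg hC v0 v1 h2 h4
      rcases le_total y ((Y:ℝ) - 1) with h | h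
      · exact mem_hseg hC l (mem_vseg hC v4 v3 h2 h) h1 h3
      · have := hC v3 v2 (a := Y - y) (b := y - (Y - 1)) (by linarith) (by linarith) (by ring)
        have e : ((Y - y : ℝ) • ((A:ℝ), (Y:ℝ) - 1) + (y - (Y - 1) : ℝ) • ((j:ℝ), (Y:ℝ)))
            = ((A:ℝ) - (y - (Y - 1)) * (A - j), y) := by
          ext <;> simp <;> ring
        rw [e] at this
        exact mem_hseg hC l this h1 h5
  have hmem : ∀ i, P.verts i ∈ ({((0:ℝ), (0:ℝ)), ((0:ℝ), (Y:ℝ)), ((j:ℝ), (Y:ℝ)),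
      ((A:ℝ), (Y:ℝ) - 1), ((A:ℝ), (0:ℝ))} : Set (ℝ × ℝ)) := by
    intro i
    rw [← hr]
    exact ⟨i, rfl⟩
  refine ⟨P, ⟨?_, ?_, ?_, ?_⟩, ?_, hp⟩
  · intro i
    rcases hmem i with h | h | h | h | h <;> rw [h]
    · exact ⟨⟨0, by simp⟩, ⟨0, by simp⟩⟩
    · exact ⟨⟨0, by simp⟩, ⟨Y, by simp⟩⟩
    · exact ⟨⟨j, by simp⟩, ⟨Y, by simp⟩⟩
    · exact ⟨⟨A, by simp⟩, ⟨Y - 1, by simp⟩⟩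
    · exact ⟨⟨A, by simp⟩, ⟨0, by simp⟩⟩
  · intro i
    rcases hmem i with h | h | h | h | h <;> rw [h] <;> simp
    linarith
  · rw [hbody]
    have q1 := mul_nonneg hY' (sub_nonneg.2 hj')
    refine ⟨?_, ?_, ?_, ?_, ?_⟩ <;> simp only <;> nlinarith
  · rw [hbody]
    rintro ⟨x, y⟩ ⟨h1, h2, h3, h4, h5⟩ ⟨x', y'⟩ ⟨⟨g1, g2⟩, g3, g4⟩
    simp only at *
    refine ⟨?_, ?_, ?_, ?_, ?_⟩ <;> simp only <;> nlinarith [mul_nonneg (sub_nonneg.2 g4) (sub_nonneg.2 hj')]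
  · have : {p ∈ P.body | IsLatticePt p} =
        (fun i : ℕ => (((i % (A + 1) : ℕ) : ℝ), ((i / (A + 1) : ℕ) : ℝ))) ''
          (Finset.range ((A + 1) * Y + j + 1) : Set ℕ) := by
      rw [hbody]
      ext ⟨x, y⟩
      constructor
      · rintro ⟨⟨h1, h2, h3, h4, h5⟩, ⟨u, hu⟩, ⟨v, hv⟩⟩
        simp only at h1 h2 h3 h4 h5 hu hv
        subst hu hv
        obtain ⟨u, rfl⟩ := Int.eq_ofNat_of_zero_le (by exact_mod_cast h1 : (0:ℤ) ≤ u)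
        obtain ⟨v, rfl⟩ := Int.eq_ofNat_of_zero_le (by exact_mod_cast h2 : (0:ℤ) ≤ v)
        have k3 : u ≤ A := by exact_mod_cast h3
        have k4 : v ≤ Y := by exact_mod_cast h4
        refine ⟨(A + 1) * v + u, ?_, ?_⟩
        · simp only [Finset.coe_range, Set.mem_Iio]
          rcases k4.eq_or_lt with h | h
          · subst h
            have : (u:ℝ) ≤ j := by push_cast at h5; linarith
            have : u ≤ j := by exact_mod_cast this
            omega
          · have : (A + 1) * (v + 1) ≤ (A + 1) * Y := Nat.mul_le_mul_left _ h
            linarith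
        · simp only [Nat.mul_add_mod, Nat.mul_add_div (Nat.succ_pos A),
            Nat.mod_eq_of_lt (Nat.lt_succ_of_le k3), Nat.div_eq_of_lt (Nat.lt_succ_of_le k3)]
          simp
      · rintro ⟨i, hi, h⟩
        simp only [Prod.mk.injEq] at h
        obtain ⟨rfl, rfl⟩ := h
        simp only [Finset.coe_range, Set.mem_Iio] at hi
        have hdm := Nat.div_add_mod i (A + 1)
        have hlt := Nat.mod_lt i (Nat.succ_pos A)
        generalize i % (A + 1) = u at *
        generalize i / (A + 1) = v at *
        have k3 : u ≤ A := by omega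
        have k4 : v ≤ Y := by
          by_contra hc
          have : (A + 1) * (Y + 1) ≤ (A + 1) * v := Nat.mul_le_mul_left _ (by omega)
          linarith
        refine ⟨⟨by simp, by simp, by simpa using k3, by simpa using k4, ?_⟩,
          ⟨u, by simp⟩, ⟨v, by simp⟩⟩
        simp only
        rcases k4.eq_or_lt with h | h
        · subst h
          have : u ≤ j := by omega
          have : (u:ℝ) ≤ j := by exact_mod_cast this
          linarith
        · have e1 : (v:ℝ) + 1 ≤ Y := by exact_mod_cast h
          have e2 : (u:ℝ) ≤ A := by exact_mod_cast k3
          nlinarith [mul_nonneg (by linarith : (0:ℝ) ≤ (Y:ℝ) - 1 - v) (sub_nonneg.2 hj')]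
    rw [latticeCount, this, Set.ncard_image_of_injective, Set.ncard_coe_finset, Finset.card_range]
    intro u v h
    simp only [Prod.mk.injEq, Nat.cast_inj] at h
    rw [← Nat.div_add_mod u (A + 1), ← Nat.div_add_mod v (A + 1), h.1, h.2]

lemma omegaPerim_nonneg (a b : ℕ) (P : ClockPolygon) :
    0 ≤ omegaPerim (Set.Icc (0 : ℝ) (a : ℝ) ×ˢ Set.Icc (0 : ℝ) (b : ℝ)) P := by
  apply Finset.sum_nonneg
  intro i _
  rw [omegaLen_rect]
  positivity

/-- For the polydisk `P(a,b)` (with `Ω = [0,a] × [0,b]`),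
`cap_{X_Ω}(2abr) = (ar + 1)(br + 1)` for every integer `r ≥ 0`. -/
theorem capFn_polydisk (a b : ℕ) (ha : 0 < a) (hb : 0 < b) :
    ∀ r : ℕ,
      capFn (Set.Icc (0 : ℝ) (a : ℝ) ×ˢ Set.Icc (0 : ℝ) (b : ℝ))
          ((2 * a * b * r : ℕ) : ℝ) =
        (a * r + 1) * (b * r + 1) := by
  intro r
  have hset : {k : ℕ | echCap (Set.Icc (0 : ℝ) (a : ℝ) ×ˢ Set.Icc (0 : ℝ) (b : ℝ)) k
      ≤ ((2 * a * b * r : ℕ) : ℝ)} = (Finset.range ((a * r + 1) * (b * r + 1)) : Set ℕ) := by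
    ext k
    simp only [Set.mem_ofPred_eq, Finset.coe_range, Set.mem_Iio]
    constructor
    · intro h
      by_contra hc
      obtain ⟨P, h1, h2, h3⟩ := exists_seg a b k
      have hlow : ((2 * a * b * r : ℕ) : ℝ) + 1 ≤
          echCap (Set.Icc (0 : ℝ) (a : ℝ) ×ˢ Set.Icc (0 : ℝ) (b : ℝ)) k := by
        rw [echCap]
        refine le_csInf (Set.nonempty_of_mem (x := (b * k : ℝ)) ⟨P, h1, h2, h3⟩) ?_
        rintro _ ⟨Q, q1, q2, rfl⟩
        exact perim_lower a b ha hb r k Q q1 q2 (by omega)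
      linarith
    · intro hk
      have hex : ∃ P : ClockPolygon, IsCompetitor P ∧ latticeCount P.body = k + 1 ∧
          omegaPerim (Set.Icc (0 : ℝ) (a : ℝ) ×ˢ Set.Icc (0 : ℝ) (b : ℝ)) P
            ≤ ((2 * a * b * r : ℕ) : ℝ) := by
        have hlt := Nat.mod_lt k (Nat.succ_pos (a * r))
        rw [Nat.succ_eq_add_one] at hlt
        have hdm := Nat.div_add_mod k (a * r + 1)
        have hd : k / (a * r + 1) < b * r + 1 := Nat.div_lt_of_lt_mul hk
        have hpar : ∀ Y : ℕ, Y ≤ b * r → b * (a * r) + a * Y ≤ 2 * a * b * r := by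
          intro Y hY
          have := Nat.mul_le_mul_left a hY
          linarith
        rcases Nat.eq_zero_or_pos (k / (a * r + 1)) with h0 | h0
        · obtain ⟨P, h1, h2, h3⟩ := exists_seg a b k
          refine ⟨P, h1, h2, ?_⟩
          rw [h3]
          have e : k ≤ a * r := by rw [h0, mul_zero] at hdm; omega
          have := hpar 0 (Nat.zero_le _)
          have := Nat.mul_le_mul_left b e
          have : b * k ≤ 2 * a * b * r := by omega
          exact_mod_cast this
        · have hr : 0 < r := by
            rcases Nat.eq_zero_or_pos r with rfl | h
            · simp at hk; subst hk; simp at h0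
            · exact h
          obtain ⟨P, h1, h2, h3⟩ := exists_full a b (a * r) (k / (a * r + 1)) (k % (a * r + 1))
            (Nat.mul_pos ha hr) h0 (by omega)
          refine ⟨P, h1, by rw [h2, hdm], ?_⟩
          rw [h3]
          exact_mod_cast hpar _ (by omega)
      obtain ⟨P, h1, h2, h3⟩ := hex
      refine le_trans (csInf_le ⟨0, ?_⟩ ⟨P, h1, h2, rfl⟩) h3
      rintro _ ⟨Q, -, -, rfl⟩
      exact omegaPerim_nonneg a b Q
  rw [capFn, hset, Set.ncard_coe_finset, Finset.card_range]

end
end
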